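/- arXiv:2102.01242 — 2 statements merged into one kernel-verified Lean document; each statement's English description precedes it below -/
import Mathlib

section
/- Let h be a real analytic function on an open neighborhood U of 0 in ℝ^n such that 0 is an isolated zero of h (i.e., there is ρ > 0 with {u : ‖u‖ < ρ ∧ h(u) = 0} = {0}). Then there exist positive constants r, c, and α such that for all u with ‖u‖ < r, we have |h(u)| ≥ c·‖u‖^α. -/
open Metric
open Filter Topology


theorem fc_term {m N : ℕ} {B : Type*} [NormedRing B] [NormedAlgebra ℝ B]
    (q : ContinuousMultilinearMap ℝ (fun _ : Fin N => (Fin m → ℝ)) ℝ)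
    (φ : B →L[ℝ] ℝ) (h1 : φ 1 = 1) (b : Fin m → B) (u : Fin m → ℝ)
    (hb : ∀ i X, φ (b i * X) = u i * φ X) :
    φ (∑ i : Fin N → Fin m, q (fun j => Pi.single (i j) 1) • (List.ofFn fun j => b (i j)).prod)
      = q (fun _ => u) := by
  have hu : (fun _ : Fin N => u) = fun _ : Fin N => ∑ k, u k • (Pi.single k (1:ℝ) : Fin m → ℝ) := by
    funext _
    ext k
    simp [Finset.sum_apply, Pi.single_apply]
  have hl : ∀ l : List (Fin m), φ (l.map b).prod = (l.map u).prod := by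
    intro l
    induction l with
    | nil => simpa using h1
    | cons a l ih => simp [hb, ih]
  rw [hu, q.map_sum, map_sum]
  refine Finset.sum_congr rfl fun i _ => ?_
  rw [q.map_smul_univ, map_smul]
  have := hl (List.ofFn i)
  rw [List.map_ofFn, List.map_ofFn] at this
  have e : (List.ofFn fun j => b (i j)) = List.ofFn (b ∘ i) := rfl
  rw [e, this, List.prod_ofFn]
  simp [mul_comm]

theorem func_calc {m : ℕ} {B : Type*} [NormedRing B] [NormedAlgebra ℝ B] [NormOneClass B]
    [CompleteSpace B] (f : (Fin m → ℝ) → ℝ) (hf : AnalyticAt ℝ f 0) :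
    ∃ F : (Fin m → B) → B, ∃ δ > (0:ℝ), AnalyticOnNhd ℝ F (ball 0 δ) ∧
      ∀ φ : B →L[ℝ] ℝ, φ 1 = 1 → ∀ (b : Fin m → B) (u : Fin m → ℝ), ‖b‖ < δ → ‖u‖ < δ →
        (∀ i X, φ (b i * X) = u i * φ X) → φ (F b) = f u := by
  obtain ⟨p, r, hp⟩ := hf
  let P : FormalMultilinearSeries ℝ (Fin m → B) B := fun N =>
    ∑ i : Fin N → Fin m, p N (fun j => Pi.single (i j) 1) •
      (ContinuousMultilinearMap.mkPiAlgebraFin ℝ N B).compContinuousLinearMap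
        (fun j => ContinuousLinearMap.proj (R := ℝ) (φ := fun _ : Fin m => B) (i j))
  have hPn : ∀ N, ‖P N‖ ≤ (m:ℝ)^N * ‖p N‖ := by
    intro N
    refine ContinuousMultilinearMap.opNorm_le_bound (by positivity) fun v => ?_
    have hv : P N v = ∑ i : Fin N → Fin m, p N (fun j => Pi.single (i j) 1) •
        (List.ofFn fun j => v j (i j)).prod := by simp [P]
    rw [hv]
    refine (norm_sum_le _ _).trans ?_
    have : ∀ i ∈ (Finset.univ : Finset (Fin N → Fin m)), ‖p N (fun j => Pi.single (i j) 1) •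
        (List.ofFn fun j => v j (i j)).prod‖ ≤ ‖p N‖ * ∏ j, ‖v j‖ := by
      intro i _
      rw [norm_smul]
      have h1 : ‖p N (fun j => Pi.single (i j) 1)‖ ≤ ‖p N‖ := by
        refine ((p N).le_opNorm _).trans ?_
        have : ∏ j : Fin N, ‖(Pi.single (i j) 1 : Fin m → ℝ)‖ ≤ 1 := by
          refine Finset.prod_le_one (fun _ _ => norm_nonneg _) fun j _ => ?_
          rw [pi_norm_le_iff_of_nonneg zero_le_one]
          intro k
          rw [Pi.single_apply]
          split_ifs <;> simp
        nlinarith [norm_nonneg (p N)]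
      have h2 : ‖(List.ofFn fun j => v j (i j)).prod‖ ≤ ∏ j, ‖v j‖ := by
        refine (List.norm_prod_le _).trans ?_
        rw [List.map_ofFn, List.prod_ofFn]
        exact Finset.prod_le_prod (fun _ _ => norm_nonneg _) fun j _ => norm_le_pi_norm (v j) (i j)
      exact mul_le_mul h1 h2 (norm_nonneg _) (norm_nonneg _)
    refine (Finset.sum_le_sum this).trans ?_
    simp [mul_assoc]
  obtain ⟨r', hr'0, hr'⟩ : ∃ r' : NNReal, 0 < r' ∧ (r' : ENNReal) < r := by
    obtain ⟨r', h1, h2⟩ := ENNReal.lt_iff_exists_nnreal_btwn.1 hp.r_pos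
    exact ⟨r', by exact_mod_cast h1, h2⟩
  obtain ⟨C, hC, hCb⟩ := p.norm_mul_pow_le_of_lt_radius (hr'.trans_le hp.r_le)
  set s : NNReal := r' / (m + 1) with hs
  have hs0 : 0 < s := by positivity
  have hsr : s ≤ r' := by
    rw [hs]
    exact div_le_self zero_le (by simp)
  have hsm : (m:ℝ) * s ≤ r' := by
    rw [hs]; push_cast
    rw [mul_div_assoc', div_le_iff₀ (by positivity)]
    have := r'.2
    nlinarith [NNReal.coe_nonneg r']
  have hrad : (s : ENNReal) ≤ P.radius := by
    refine P.le_radius_of_bound C fun N => ?_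
    calc ‖P N‖ * (s:ℝ)^N ≤ ((m:ℝ)^N * ‖p N‖) * (s:ℝ)^N := by gcongr; exact hPn N
      _ = ‖p N‖ * ((m:ℝ) * s)^N := by rw [mul_pow]; ring
      _ ≤ ‖p N‖ * (r':ℝ)^N := by gcongr
      _ ≤ C := hCb N
  have hPb : HasFPowerSeriesOnBall P.sum P 0 P.radius :=
    P.hasFPowerSeriesOnBall (lt_of_lt_of_le (by exact_mod_cast hs0) hrad)
  refine ⟨P.sum, s, by exact_mod_cast hs0, ?_, ?_⟩
  · intro x hx
    refine hPb.analyticAt_of_mem ?_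
    refine Metric.eball_subset_eball hrad ?_
    rw [Metric.eball_coe]; exact hx
  · intro φ h1 b u hb hu hbu
    have hb' : b ∈ Metric.eball (0 : Fin m → B) P.radius := by
      refine Metric.eball_subset_eball hrad ?_
      rw [Metric.eball_coe]; simpa using hb
    have hu' : u ∈ Metric.eball (0 : Fin m → ℝ) r := by
      refine Metric.eball_subset_eball ((ENNReal.coe_le_coe.2 hsr).trans hr'.le) ?_
      rw [Metric.eball_coe]; simpa using hu
    have k1 := (hPb.hasSum hb').mapL φ
    have k2 := hp.hasSum hu'
    rw [zero_add] at k1 k2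
    have e : (fun N => φ (P N fun _ => b)) = fun N => p N fun _ => u := by
      funext N
      rw [← fc_term (p N) φ h1 b u hbu]
      simp [P]
    rw [e] at k1
    exact k1.unique k2


def AA : Type := BoundedContinuousFunction ℕ ℝ

noncomputable instance : NormedAddCommGroup AA :=
  inferInstanceAs (NormedAddCommGroup (BoundedContinuousFunction ℕ ℝ))

noncomputable instance : NormedSpace ℝ AA :=
  inferInstanceAs (NormedSpace ℝ (BoundedContinuousFunction ℕ ℝ))

instance : CompleteSpace AA :=
  inferInstanceAs (CompleteSpace (BoundedContinuousFunction ℕ ℝ))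

def AA.c (q : AA) (k : ℕ) : ℝ := (show BoundedContinuousFunction ℕ ℝ from q) k

instance : CoeFun AA (fun _ => ℕ → ℝ) := ⟨AA.c⟩

theorem AA.ext {p q : AA} (h : ∀ k, p k = q k) : p = q := BoundedContinuousFunction.ext h

theorem AA.add_apply (p q : AA) (k : ℕ) : (p + q) k = p k + q k := rfl
theorem AA.smul_apply (r : ℝ) (q : AA) (k : ℕ) : (r • q) k = r * q k := rfl
theorem AA.zero_apply (k : ℕ) : (0 : AA) k = 0 := rfl

theorem AA.le_norm (q : AA) (k : ℕ) : ‖q k‖ ≤ ‖q‖ :=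
  BoundedContinuousFunction.norm_coe_le_norm (α := ℕ) (β := ℝ) q k

theorem AA.norm_le {q : AA} {C : ℝ} (hC : 0 ≤ C) (h : ∀ k, ‖q k‖ ≤ C) : ‖q‖ ≤ C :=
  (BoundedContinuousFunction.norm_le (α := ℕ) (β := ℝ) hC).2 h

noncomputable def AA.mk (f : ℕ → ℝ) (C : ℝ) (h : ∀ k, ‖f k‖ ≤ C) : AA :=
  BoundedContinuousFunction.ofNormedAddCommGroupDiscrete f C h

theorem AA.mk_apply (f : ℕ → ℝ) (C : ℝ) (h : ∀ k, ‖f k‖ ≤ C) (k : ℕ) : AA.mk f C h k = f k := rfl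

noncomputable def shL : AA →L[ℝ] AA :=
  LinearMap.mkContinuous
    { toFun := fun q => AA.mk (fun k => q (k + 1)) ‖q‖ (fun k => q.le_norm _)
      map_add' := fun _ _ => AA.ext fun _ => rfl
      map_smul' := fun _ _ => AA.ext fun _ => rfl } 1 (fun q => by
        rw [one_mul]
        exact AA.norm_le (norm_nonneg _) fun k => q.le_norm _)

noncomputable def shSfun (q : AA) : AA :=
  AA.mk (fun k : ℕ => if k = 0 then 0 else q (k - 1)) ‖q‖ (fun k => by
      by_cases hk : k = 0
      · simp [hk]
      · simpa [hk] using q.le_norm _)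

theorem shSfun_apply (q : AA) (k : ℕ) : shSfun q k = if k = 0 then 0 else q (k - 1) := rfl

noncomputable def shS : AA →L[ℝ] AA :=
  LinearMap.mkContinuous
    { toFun := shSfun
      map_add' := fun a b => by
        refine AA.ext fun k => ?_
        simp only [shSfun_apply, AA.add_apply]
        split_ifs <;> simp
      map_smul' := fun a b => by
        refine AA.ext fun k => ?_
        simp only [shSfun_apply, AA.smul_apply]
        split_ifs <;> simp } 1 (fun q => by
        rw [one_mul]
        refine AA.norm_le (norm_nonneg _) fun k => ?_
        change ‖shSfun q k‖ ≤ ‖q‖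
        rw [shSfun_apply]
        split_ifs
        · simp
        · exact q.le_norm _)

noncomputable def ee0 : AA →L[ℝ] ℝ :=
  LinearMap.mkContinuous
    { toFun := fun q => q 0
      map_add' := fun _ _ => rfl
      map_smul' := fun _ _ => rfl } 1 (fun q => by
        rw [one_mul]
        exact q.le_norm 0)

noncomputable def dl : AA :=
  AA.mk (fun k : ℕ => if k = 0 then 1 else 0) 1 (fun k => by split_ifs <;> simp)

theorem dl_apply (k : ℕ) : dl k = if k = 0 then 1 else 0 := rfl
theorem shL_apply (q : AA) (k : ℕ) : shL q k = q (k+1) := rfl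
theorem shS_zero (q : AA) : shS q 0 = 0 := rfl
theorem shS_succ (q : AA) (k : ℕ) : shS q (k+1) = q k := rfl
theorem ee0_apply (q : AA) : ee0 q = q 0 := rfl

instance : Nontrivial AA := ⟨dl, 0, fun h => by
  have := congrArg (fun q : AA => q 0) h
  simp [dl_apply, AA.zero_apply] at this⟩

theorem shL_norm : ‖shL‖ ≤ 1 := LinearMap.mkContinuous_norm_le _ zero_le_one _

theorem sh_decomp (q : AA) : q = shS (shL q) + q 0 • dl := by
  refine AA.ext fun k => ?_
  cases k with
  | zero => simp [shS_zero, dl_apply, AA.add_apply, AA.smul_apply]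
  | succ k => simp [shS_succ, shL_apply, dl_apply, AA.add_apply, AA.smul_apply]

theorem shL_shS (q : AA) : shL (shS q) = q := by
  refine AA.ext fun k => ?_; rw [shL_apply, shS_succ]

theorem shL_pow_apply (d : ℕ) (q : AA) (k : ℕ) : (shL ^ d) q k = q (k + d) := by
  induction d generalizing q k with
  | zero => simp
  | succ d ih => rw [pow_succ, mul_apply_eq_comp, ih, shL_apply]; rfl

theorem shS_pow_apply (d : ℕ) (q : AA) (k : ℕ) :
    (shS ^ d) q k = if k < d then 0 else q (k - d) := by
  induction d generalizing q k with
  | zero => simp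
  | succ d ih =>
    rw [pow_succ, mul_apply_eq_comp, ih]
    by_cases h : k < d
    · simp [h, Nat.lt_succ_of_lt h]
    · rw [if_neg h]
      rcases Nat.eq_or_lt_of_le (not_lt.1 h) with h' | h'
      · subst h'; simp [shS_zero]
      · rw [if_neg (by omega)]
        obtain ⟨j, rfl⟩ : ∃ j, k = d + 1 + j := ⟨k - (d+1), by omega⟩
        rw [show d + 1 + j - d = j + 1 by omega, shS_succ, show d + 1 + j - (d+1) = j by omega]

noncomputable def ev (t : ℝ) : AA →L[ℝ] ℝ := ee0 ∘L (Ring.inverse (1 - t • shL))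

theorem ev_unit {t : ℝ} (ht : |t| < 1) : IsUnit (1 - t • shL) := by
  refine isUnit_one_sub_of_norm_lt_one (R := AA →L[ℝ] AA) ?_
  rw [norm_smul, Real.norm_eq_abs]
  nlinarith [shL_norm, abs_nonneg t, norm_nonneg shL]

theorem ev_inv {t : ℝ} (ht : |t| < 1) (q : AA) :
    (Ring.inverse (1 - t • shL)) (q - t • shL q) = q := by
  have := Ring.inverse_mul_cancel _ (ev_unit ht)
  have h2 := congrArg (fun T : AA →L[ℝ] AA => T q) this
  simpa using h2

theorem ev_shS {t : ℝ} (ht : |t| < 1) (q : AA) : ev t (shS q) = t * ev t q := by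
  have h := ev_inv ht (shS q)
  rw [shL_shS, map_sub, map_smul, sub_eq_iff_eq_add] at h
  simp only [ev, ContinuousLinearMap.comp_apply]
  rw [h, map_add, map_smul, ee0_apply, shS_zero]
  simp

theorem ev_shS_pow {t : ℝ} (ht : |t| < 1) (d : ℕ) (q : AA) :
    ev t ((shS ^ d) q) = t ^ d * ev t q := by
  induction d generalizing q with
  | zero => simp
  | succ d ih => rw [pow_succ, mul_apply_eq_comp, ih, ev_shS ht]; ring

theorem ev_dl {t : ℝ} (ht : |t| < 1) : ev t dl = 1 := by
  have hL : shL dl = 0 := by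
    refine AA.ext fun k => ?_; rw [shL_apply, dl_apply, if_neg (by omega)]; rfl
  have h := ev_inv ht dl
  rw [hL, smul_zero, sub_zero] at h
  simp only [ev, ContinuousLinearMap.comp_apply]
  rw [h, ee0_apply, dl_apply]; simp

theorem ev_zero : ev 0 = ee0 := by
  ext q; simp only [ev, zero_smul, sub_zero]; rw [Ring.inverse_one]; rfl

theorem ev_analytic : AnalyticAt ℝ ev 0 := by
  have h1 : AnalyticAt ℝ (fun t : ℝ => (1 : AA →L[ℝ] AA) - t • shL) 0 :=
    analyticAt_const.sub (((ContinuousLinearMap.id ℝ ℝ).smulRight shL).analyticAt 0)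
  have h2 : AnalyticAt ℝ (Ring.inverse : (AA →L[ℝ] AA) → _) (((1 : (AA →L[ℝ] AA)ˣ) : AA →L[ℝ] AA)) :=
    analyticAt_inverse (𝕜 := ℝ) (A := AA →L[ℝ] AA) 1
  have h3 : AnalyticAt ℝ (fun t : ℝ => Ring.inverse ((1 : AA →L[ℝ] AA) - t • shL)) 0 := by
    refine AnalyticAt.fun_comp (g := Ring.inverse) ?_ h1
    simpa using h2
  have h4 := (ContinuousLinearMap.compL ℝ AA AA ℝ ee0).analyticAt
    (Ring.inverse ((1 : AA →L[ℝ] AA) - (0:ℝ) • shL))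
  exact AnalyticAt.fun_comp (g := ContinuousLinearMap.compL ℝ AA AA ℝ ee0) h4 h3

theorem curry_lemma {Y : Type*} [NormedAddCommGroup Y] [NormedSpace ℝ Y] [FiniteDimensional ℝ Y]
    (f : Y × ℝ → ℝ) (hf : AnalyticAt ℝ f 0) :
    ∃ ρ > (0:ℝ), ∃ F : Y → AA, AnalyticAt ℝ F 0 ∧
      ∀ᶠ y in 𝓝 (0:Y), ∀ t : ℝ, |t| < 1 → ev t (F y) = f (y, ρ * t) := by
  let m := Module.finrank ℝ (Y × ℝ)
  let e : (Y × ℝ) ≃L[ℝ] (Fin m → ℝ) := ContinuousLinearEquiv.ofFinrankEq (by simp [m])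
  have hfe : AnalyticAt ℝ (fun u => f (e.symm u)) 0 := by
    refine AnalyticAt.fun_comp (g := f) ?_ (e.symm.analyticAt 0)
    simpa using hf
  obtain ⟨G, δ, hδ, hG, hGe⟩ := func_calc (B := AA →L[ℝ] AA) _ hfe
  let w := e (0, 1)
  obtain ⟨ρ, hρ, hρ1, hρ2⟩ : ∃ ρ > (0:ℝ), ρ * ‖w‖ < δ / 2 ∧ ρ * (‖w‖ * ‖shS‖) < δ / 2 := by
    refine ⟨δ / 2 / (‖w‖ * ‖shS‖ + ‖w‖ + 1), by positivity, ?_, ?_⟩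
    · rw [div_mul_eq_mul_div, div_lt_iff₀ (by positivity)]
      have : 0 ≤ ‖w‖ * ‖shS‖ := by positivity
      have : ‖w‖ < ‖w‖ * ‖shS‖ + ‖w‖ + 1 := by linarith
      gcongr
    · rw [div_mul_eq_mul_div, div_lt_iff₀ (by positivity)]
      have : 0 ≤ ‖w‖ := by positivity
      have : ‖w‖ * ‖shS‖ < ‖w‖ * ‖shS‖ + ‖w‖ + 1 := by linarith
      gcongr
  let b : Y → (Fin m → (AA →L[ℝ] AA)) := fun y i => (e (y, 0) i) • 1 + (ρ * w i) • shS
  have hbA : AnalyticAt ℝ b 0 := by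
    have : b = fun y => (ContinuousLinearMap.pi fun i =>
      (((ContinuousLinearMap.proj (R := ℝ) (φ := fun _ : Fin m => ℝ) i ∘L (e : Y × ℝ →L[ℝ] _)) ∘L
        ContinuousLinearMap.inl ℝ Y ℝ).smulRight (1 : AA →L[ℝ] AA)) :
        Y →L[ℝ] (Fin m → (AA →L[ℝ] AA))) y + fun i => (ρ * w i) • shS := by
      funext y i; simp [b]
    rw [this]
    exact (ContinuousLinearMap.analyticAt _ _).add analyticAt_const
  have hb0 : ‖b 0‖ < δ := by
    refine lt_of_le_of_lt ((pi_norm_le_iff_of_nonneg (r := ρ * (‖w‖ * ‖shS‖)) (by positivity)).2 ?_)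
      (by linarith)
    intro i
    have : e ((0:Y), (0:ℝ)) = 0 := map_zero e
    simp only [b, this, Pi.zero_apply, zero_smul, zero_add, norm_smul, norm_mul, Real.norm_eq_abs,
      abs_of_pos hρ]
    rw [mul_assoc]
    gcongr
    exact norm_le_pi_norm w i
  refine ⟨ρ, hρ, fun y => (G (b y)) dl, ?_, ?_⟩
  · have h1 : AnalyticAt ℝ G (b 0) := hG _ (by simpa using hb0)
    have h2 := h1.fun_comp hbA
    exact ((ContinuousLinearMap.apply ℝ AA dl).analyticAt _).fun_comp h2
  · have c1 : ∀ᶠ y in 𝓝 (0:Y), ‖b y‖ < δ :=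
      (hbA.continuousAt.norm).eventually (gt_mem_nhds hb0)
    have c2 : ∀ᶠ y in 𝓝 (0:Y), ‖e (y, 0)‖ < δ / 2 := by
      have : ContinuousAt (fun y : Y => ‖e (y, 0)‖) 0 := by fun_prop
      refine this.eventually (gt_mem_nhds ?_)
      have : e ((0:Y), (0:ℝ)) = 0 := map_zero e
      simp only [this, norm_zero]; positivity
    filter_upwards [c1, c2] with y hy1 hy2 t ht
    have hu : e (y, ρ * t) = e (y, 0) + (ρ * t) • w := by
      simp only [w, ← map_smul, ← map_add]; simp
    have key := hGe ((ev t) ∘L (ContinuousLinearMap.apply ℝ AA dl)) (by simp [ev_dl ht])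
      (b y) (e (y, ρ * t)) hy1 ?_ ?_
    · simpa using key
    · rw [hu]
      refine (norm_add_le _ _).trans_lt ?_
      rw [norm_smul, norm_mul, Real.norm_eq_abs, Real.norm_eq_abs, abs_of_pos hρ]
      have : ρ * |t| * ‖w‖ ≤ ρ * ‖w‖ := by
        have : 0 ≤ ρ * ‖w‖ := by positivity
        nlinarith [abs_nonneg t]
      linarith
    · intro i X
      rw [hu]
      simp [b, ev_shS ht]
      ring


noncomputable def cdL (k : ℕ) : AA →L[ℝ] ℝ := ee0 ∘L (shL ^ k)

theorem cdL_apply (k : ℕ) (q : AA) : cdL k q = q k := by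
  change ee0 ((shL ^ k) q) = q k
  rw [ee0_apply, shL_pow_apply, zero_add]

theorem shSL_of_zero {d : ℕ} {q : AA} (h : ∀ k < d, q k = 0) : (shS ^ d) ((shL ^ d) q) = q := by
  refine AA.ext fun k => ?_
  rw [shS_pow_apply]
  split_ifs with hk
  · exact (h k hk).symm
  · rw [shL_pow_apply]; congr 1; omega

theorem tri_inj {d : ℕ} (q0 : AA) (hq : q0 0 ≠ 0) (a : Fin d → ℝ)
    (h : ∀ k : Fin d, ∑ i : Fin d, a i * (shS ^ (i:ℕ)) q0 k = 0) : a = 0 := by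
  have : ∀ k : ℕ, ∀ hk : k < d, a ⟨k, hk⟩ = 0 := by
    intro k
    induction k using Nat.strong_induction_on with
    | _ k ih =>
      intro hk
      have h1 := h ⟨k, hk⟩
      rw [Finset.sum_eq_single (⟨k, hk⟩ : Fin d)] at h1
      · simp only [shS_pow_apply, lt_irrefl, if_false, Nat.sub_self, mul_eq_zero] at h1
        exact h1.resolve_right hq
      · intro i _ hi
        have hik : (i:ℕ) ≠ k := fun h => hi (Fin.ext h)
        rcases lt_or_gt_of_ne hik with h2 | h2
        · have := ih i h2 i.2
          rw [Fin.eta] at this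
          simp [this]
        · rw [shS_pow_apply, if_pos h2, mul_zero]
      · simp
  funext i
  exact this i i.2

noncomputable def psiD (d : ℕ) (q0 : AA) : (AA × (Fin d → ℝ)) →L[ℝ] AA :=
  (shS ^ d) ∘L ContinuousLinearMap.fst ℝ AA (Fin d → ℝ) +
    ∑ i : Fin d, ((ContinuousLinearMap.proj (R := ℝ) (φ := fun _ : Fin d => ℝ) i) ∘L
      ContinuousLinearMap.snd ℝ AA (Fin d → ℝ)).smulRight ((shS ^ (i:ℕ)) q0)

theorem psiD_apply (d : ℕ) (q0 : AA) (z : AA × (Fin d → ℝ)) :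
    psiD d q0 z = (shS ^ d) z.1 + ∑ i : Fin d, z.2 i • (shS ^ (i:ℕ)) q0 := by
  simp [psiD]

theorem psiD_coord (d : ℕ) (q0 : AA) (z : AA × (Fin d → ℝ)) (k : ℕ) :
    psiD d q0 z k = (shS ^ d) z.1 k + ∑ i : Fin d, z.2 i * (shS ^ (i:ℕ)) q0 k := by
  simp only [← cdL_apply]
  rw [psiD_apply]
  simp

theorem psiD_inj (d : ℕ) (q0 : AA) (hq : q0 0 ≠ 0) : (psiD d q0).ker = ⊥ := by
  rw [LinearMap.ker_eq_bot']
  intro z hz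
  have hz' : psiD d q0 z = 0 := hz
  have h2 : z.2 = 0 := by
    refine tri_inj q0 hq _ fun k => ?_
    have := psiD_coord d q0 z k
    rw [hz', shS_pow_apply, if_pos k.2, zero_add] at this
    exact this.symm
  have h1 : z.1 = 0 := by
    refine AA.ext fun k => ?_
    have := psiD_coord d q0 z (k + d)
    rw [hz', h2, shS_pow_apply, if_neg (by omega), Nat.add_sub_cancel] at this
    simp only [Pi.zero_apply, zero_mul, Finset.sum_const_zero, add_zero] at this
    exact this.symm
  exact Prod.ext h1 h2

theorem psiD_surj (d : ℕ) (q0 : AA) (hq : q0 0 ≠ 0) : (psiD d q0).range = ⊤ := by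
  rw [LinearMap.range_eq_top]
  intro F
  let T : (Fin d → ℝ) →ₗ[ℝ] (Fin d → ℝ) :=
    { toFun := fun a k => ∑ i : Fin d, a i * (shS ^ (i:ℕ)) q0 k
      map_add' := fun a b => by ext k; simp [add_mul, Finset.sum_add_distrib]
      map_smul' := fun a b => by ext k; simp [mul_assoc, Finset.mul_sum] }
  have hT : Function.Injective T := by
    rw [← LinearMap.ker_eq_bot, LinearMap.ker_eq_bot']
    intro a ha
    exact tri_inj q0 hq a fun k => congrFun ha k
  obtain ⟨a, ha⟩ := (LinearMap.injective_iff_surjective.1 hT) (fun k => F k)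
  let R := F - ∑ i : Fin d, a i • (shS ^ (i:ℕ)) q0
  have hR : ∀ k < d, R k = 0 := by
    intro k hk
    have := congrFun ha ⟨k, hk⟩
    simp only [T, LinearMap.coe_mk, AddHom.coe_mk] at this
    simp only [R, ← cdL_apply] at this ⊢
    simp [← this]
  refine ⟨((shL ^ d) R, a), ?_⟩
  change psiD d q0 _ = F
  rw [psiD_apply]
  simp only
  rw [shSL_of_zero hR]
  simp [R]

noncomputable def psi (d : ℕ) (z : AA × (Fin d → ℝ)) : AA :=
  (shS ^ d) z.1 + ∑ i : Fin d, z.2 i • (shS ^ (i:ℕ)) z.1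

theorem psi_analytic (d : ℕ) (z : AA × (Fin d → ℝ)) : AnalyticAt ℝ (psi d) z := by
  unfold psi
  refine AnalyticAt.add (((shS ^ d) ∘L ContinuousLinearMap.fst ℝ AA (Fin d → ℝ)).analyticAt z) ?_
  refine Finset.analyticAt_fun_sum _ fun i _ => ?_
  have h1 : AnalyticAt ℝ (fun z : AA × (Fin d → ℝ) => z.2 i) z :=
    ((ContinuousLinearMap.proj (R := ℝ) (φ := fun _ : Fin d => ℝ) i) ∘L
      ContinuousLinearMap.snd ℝ AA (Fin d → ℝ)).analyticAt z
  have h2 : AnalyticAt ℝ (fun z : AA × (Fin d → ℝ) => (shS ^ (i:ℕ)) z.1) z :=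
    ((shS ^ (i:ℕ)) ∘L ContinuousLinearMap.fst ℝ AA (Fin d → ℝ)).analyticAt z
  exact h1.smul h2

theorem psi_deriv (d : ℕ) (q0 : AA) : HasFDerivAt (psi d) (psiD d q0) (q0, 0) := by
  unfold psi psiD
  refine HasFDerivAt.add (((shS ^ d) ∘L ContinuousLinearMap.fst ℝ AA (Fin d → ℝ)).hasFDerivAt) ?_
  refine HasFDerivAt.fun_sum fun i _ => ?_
  have h1 := ((ContinuousLinearMap.proj (R := ℝ) (φ := fun _ : Fin d => ℝ) i) ∘L
      ContinuousLinearMap.snd ℝ AA (Fin d → ℝ)).hasFDerivAt (x := (q0, (0 : Fin d → ℝ)))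
  have h2 := ((shS ^ (i:ℕ)) ∘L ContinuousLinearMap.fst ℝ AA (Fin d → ℝ)).hasFDerivAt
    (x := (q0, (0 : Fin d → ℝ)))
  have h3 := h1.smul h2
  refine (HasFDerivAt.congr_fderiv h3 ?_)
  refine ContinuousLinearMap.ext fun z => ?_
  change (0:ℝ) • _ + z.2 i • (shS ^ (i:ℕ)) q0 = z.2 i • (shS ^ (i:ℕ)) q0
  rw [zero_smul, zero_add]

theorem ev_psi {t : ℝ} (ht : |t| < 1) (d : ℕ) (z : AA × (Fin d → ℝ)) :
    ev t (psi d z) = (t ^ d + ∑ i : Fin d, z.2 i * t ^ (i:ℕ)) * ev t z.1 := by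
  simp only [psi, map_add, map_sum, map_smul, ev_shS_pow ht, smul_eq_mul, add_mul, Finset.sum_mul]
  congr 1
  exact Finset.sum_congr rfl fun i _ => by ring

theorem wprep {Y : Type*} [NormedAddCommGroup Y] [NormedSpace ℝ Y] [FiniteDimensional ℝ Y]
    (f : Y × ℝ → ℝ) (hf : AnalyticAt ℝ f 0) (hf0 : ¬ ∀ᶠ t in 𝓝 (0:ℝ), f (0, t) = 0) :
    ∃ (d : ℕ) (a : Fin d → Y → ℝ), (∀ i, AnalyticAt ℝ (a i) 0) ∧
      ∀ᶠ z in 𝓝 (0 : Y × ℝ), f z = 0 → z.2 ^ d + ∑ i : Fin d, a i z.1 * z.2 ^ (i:ℕ) = 0 := by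
  obtain ⟨ρ, hρ, F, hF, hFe⟩ := curry_lemma f hf
  have hne : F 0 ≠ 0 := by
    intro h0
    apply hf0
    have : ∀ᶠ t in 𝓝 (0:ℝ), |t| < ρ := by
      have : ContinuousAt (fun t : ℝ => |t|) 0 := by fun_prop
      exact this.eventually (gt_mem_nhds (by simpa using hρ))
    filter_upwards [this] with t ht
    have := hFe.self_of_nhds (t / ρ) (by rw [abs_div, abs_of_pos hρ, div_lt_one hρ]; exact ht)
    rw [h0, map_zero] at this
    rw [mul_div_cancel₀ _ hρ.ne'] at this
    exact this.symm
  have hex : ∃ k, F 0 k ≠ 0 := by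
    by_contra! h
    exact hne (AA.ext h)
  classical
  let d := Nat.find hex
  have hd : F 0 d ≠ 0 := Nat.find_spec hex
  have hdm : ∀ k < d, F 0 k = 0 := fun k hk => not_not.1 (Nat.find_min hex hk)
  let q0 := (shL ^ d) (F 0)
  have hq0 : q0 0 ≠ 0 := by
    change ((shL ^ d) (F 0)) 0 ≠ 0
    rw [shL_pow_apply, zero_add]; exact hd
  have hpsi0 : psi d (q0, 0) = F 0 := by
    simp only [psi, q0, Pi.zero_apply, zero_smul, Finset.sum_const_zero, add_zero]
    exact shSL_of_zero hdm
  let i := ContinuousLinearEquiv.ofBijective (psiD d q0) (psiD_inj d q0 hq0) (psiD_surj d q0 hq0)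
  have hi : (i : (AA × (Fin d → ℝ)) →L[ℝ] AA) = psiD d q0 :=
    ContinuousLinearEquiv.coe_ofBijective _ _ _
  have hs : HasStrictFDerivAt (psi d) (i : (AA × (Fin d → ℝ)) →L[ℝ] AA) (q0, 0) := by
    have := (psi_analytic d (q0, 0)).hasStrictFDerivAt
    rwa [(psi_deriv d q0).fderiv, ← hi] at this
  let R := hs.toOpenPartialHomeomorph _
  have hRs : (q0, 0) ∈ R.source := hs.mem_toOpenPartialHomeomorph_source
  have hRc : (R : _ → AA) = psi d := hs.toOpenPartialHomeomorph_coe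
  have hRa : AnalyticAt ℝ R.symm (F 0) := by
    rw [← hpsi0, ← hRc]
    refine R.analyticAt_symm' (i := i) hRs ?_ ?_
    · rw [hRc]; exact psi_analytic _ _
    · rw [hRc, hi]; exact (psi_deriv d q0).fderiv
  have hW : AnalyticAt ℝ (fun y => R.symm (F y)) 0 := hRa.fun_comp hF
  have hW0 : R.symm (F 0) = (q0, 0) := by
    rw [← hpsi0, ← hRc]; exact R.left_inv hRs
  have hWe : ∀ᶠ y in 𝓝 (0:Y), psi d (R.symm (F y)) = F y := by
    have := hs.eventually_right_inverse
    rw [hpsi0] at this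
    exact hF.continuousAt.eventually this
  have hW1 : AnalyticAt ℝ (fun y => (R.symm (F y)).1) 0 :=
    ((ContinuousLinearMap.fst ℝ AA (Fin d → ℝ)).analyticAt _).fun_comp hW
  have hW2 : ∀ i, AnalyticAt ℝ (fun y => (R.symm (F y)).2 i) 0 := fun i =>
    (((ContinuousLinearMap.proj (R := ℝ) (φ := fun _ : Fin d => ℝ) i) ∘L
      ContinuousLinearMap.snd ℝ AA (Fin d → ℝ)).analyticAt _).fun_comp hW
  refine ⟨d, fun i y => (R.symm (F y)).2 i * ρ ^ (d - (i:ℕ)), fun i =>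
    (hW2 i).mul analyticAt_const, ?_⟩
  have c1 : ∀ᶠ z in 𝓝 (0 : Y × ℝ), |z.2 / ρ| < 1 := by
    have : ContinuousAt (fun z : Y × ℝ => |z.2 / ρ|) 0 := by fun_prop
    exact this.eventually (gt_mem_nhds (by simp))
  have c2 : ∀ᶠ z in 𝓝 (0 : Y × ℝ), ev (z.2 / ρ) (R.symm (F z.1)).1 ≠ 0 := by
    have k1 : ContinuousAt (fun z : Y × ℝ => ev (z.2 / ρ)) 0 := by
      refine ContinuousAt.comp (g := ev) (f := fun z : Y × ℝ => z.2 / ρ) ?_ (by fun_prop)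
      simpa using ev_analytic.continuousAt
    have k2 : ContinuousAt (fun z : Y × ℝ => (R.symm (F z.1)).1) 0 :=
      ContinuousAt.comp (g := fun y => (R.symm (F y)).1) (f := fun z : Y × ℝ => z.1)
        hW1.continuousAt (by fun_prop)
    refine (k1.clm_apply k2).eventually_ne ?_
    simp only [Prod.snd_zero, zero_div, Prod.fst_zero, hW0, ev_zero, ee0_apply]
    exact hq0
  have c3 := (continuous_fst (X := Y) (Y := ℝ)).continuousAt (x := 0) |>.eventually
    (hFe.and hWe)
  filter_upwards [c1, c2, c3] with z h1 h2 h3 hz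
  have h4 := h3.1 (z.2 / ρ) h1
  rw [mul_div_cancel₀ _ hρ.ne', ← h3.2, ev_psi h1] at h4
  have h5 : f (z.1, z.2) = 0 := hz
  rw [h5, mul_eq_zero] at h4
  have h6 := h4.resolve_right h2
  have h7 := congrArg (fun x => ρ ^ d * x) h6
  simp only [mul_add, mul_zero, Finset.mul_sum, div_pow] at h7
  rw [← h7]
  congr 1
  · field_simp
  · refine Finset.sum_congr rfl fun i _ => ?_
    have : ρ ^ d = ρ ^ (d - (i:ℕ)) * ρ ^ (i:ℕ) := by
      rw [← pow_add]; congr 1; have := i.2; omega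
    rw [this]; field_simp


theorem an_ball {V E : Type*} [NormedAddCommGroup V] [NormedSpace ℝ V] [NormedAddCommGroup E]
    [NormedSpace ℝ E] {F : V → E} {x : V} (hF : AnalyticAt ℝ F x) [CompleteSpace E] :
    ∃ r > (0:ℝ), AnalyticOnNhd ℝ F (ball x r) := by
  obtain ⟨r, hr, h⟩ := Metric.eventually_nhds_iff_ball.1 hF.eventually_analyticAt
  exact ⟨r, hr, h⟩

theorem an_zero_ball {V E : Type*} [NormedAddCommGroup V] [NormedSpace ℝ V] [NormedAddCommGroup E]
    [NormedSpace ℝ E] {F : V → E} {x y : V} {r : ℝ} (hF : AnalyticOnNhd ℝ F (ball x r))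
    (hy : y ∈ ball x r) (h0 : ∀ᶠ z in 𝓝 y, F z = 0) : ∀ z ∈ ball x r, F z = 0 :=
  hF.eqOn_zero_of_preconnected_of_eventuallyEq_zero (convex_ball x r).isPreconnected hy h0

theorem divis {V : Type*} [NormedAddCommGroup V] [NormedSpace ℝ V] [FiniteDimensional ℝ V]
    (P : V × ℝ → ℝ) (hP : AnalyticAt ℝ P 0) (hne : ¬ ∀ᶠ z in 𝓝 (0 : V × ℝ), P z = 0) :
    ∃ (k : ℕ) (Q : V × ℝ → ℝ), AnalyticAt ℝ Q 0 ∧ (¬ ∀ᶠ x in 𝓝 (0:V), Q (x, 0) = 0) ∧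
      ∀ᶠ z in 𝓝 (0 : V × ℝ), P z = z.2 ^ k * Q z := by
  obtain ⟨ρ, hρ, F, hF, hFe⟩ := curry_lemma P hP
  have c1 : ∀ᶠ z in 𝓝 (0 : V × ℝ), |z.2 / ρ| < 1 := by
    have : ContinuousAt (fun z : V × ℝ => |z.2 / ρ|) 0 := by fun_prop
    exact this.eventually (gt_mem_nhds (by simp))
  have cF := (continuous_fst (X := V) (Y := ℝ)).continuousAt (x := 0) |>.eventually hFe
  have hex : ∃ k, ¬ ∀ᶠ x in 𝓝 (0:V), F x k = 0 := by
    by_contra! h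
    obtain ⟨r, hr, hb⟩ := an_ball hF
    have hz : ∀ x ∈ ball (0:V) r, F x = 0 := by
      intro x hx
      refine AA.ext fun k => ?_
      have h1 : AnalyticOnNhd ℝ (fun x => cdL k (F x)) (ball 0 r) := fun x hx =>
        ((cdL k).analyticAt _).fun_comp (hb x hx)
      have := an_zero_ball h1 (mem_ball_self hr) (by simpa only [cdL_apply] using h k) x hx
      rwa [cdL_apply] at this
    apply hne
    have c2 := (continuous_fst (X := V) (Y := ℝ)).continuousAt (x := 0) |>.eventually
      (ball_mem_nhds (0:V) hr)
    filter_upwards [c1, cF, c2] with z h1 h2 h3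
    have h4 := h2 _ h1
    rw [mul_div_cancel₀ _ hρ.ne', hz _ h3, map_zero] at h4
    exact h4.symm
  classical
  let k := Nat.find hex
  have hk : ¬ ∀ᶠ x in 𝓝 (0:V), F x k = 0 := Nat.find_spec hex
  have hkm : ∀ j < k, ∀ᶠ x in 𝓝 (0:V), F x j = 0 := fun j hj => not_not.1 (Nat.find_min hex hj)
  have hkm' : ∀ᶠ x in 𝓝 (0:V), ∀ j < k, F x j = 0 := by
    have := (Finset.eventually_all (Finset.range k) (l := 𝓝 (0:V))
      (p := fun j x => F x j = 0)).2 (fun j hj => hkm j (Finset.mem_range.1 hj))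
    filter_upwards [this] with x hx j hj using hx j (Finset.mem_range.2 hj)
  refine ⟨k, fun z => (ρ ^ k)⁻¹ * ev (z.2 / ρ) ((shL ^ k) (F z.1)), ?_, ?_, ?_⟩
  · have h1 : AnalyticAt ℝ (fun z : V × ℝ => ev (z.2 / ρ)) 0 := by
      refine AnalyticAt.fun_comp (g := ev) (f := fun z : V × ℝ => z.2 / ρ) ?_ ?_
      · simpa using ev_analytic
      · exact analyticAt_snd.div_const
    have h2 : AnalyticAt ℝ (fun z : V × ℝ => (shL ^ k) (F z.1)) 0 := by
      refine AnalyticAt.fun_comp (g := fun q => (shL ^ k) q) ((shL ^ k).analyticAt _) ?_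
      exact AnalyticAt.fun_comp (g := F) hF analyticAt_fst
    have hb : AnalyticAt ℝ (fun q : (AA →L[ℝ] ℝ) × AA => q.1 q.2)
        (ev ((0 : V × ℝ).2 / ρ), (shL ^ k) (F (0 : V × ℝ).1)) :=
      (ContinuousLinearMap.id ℝ (AA →L[ℝ] ℝ)).analyticAt_bilinear _
    exact analyticAt_const.mul (AnalyticAt.fun_comp
      (f := fun z : V × ℝ => (ev (z.2 / ρ), (shL ^ k) (F z.1))) hb (h1.prod h2))
  · intro h
    apply hk
    filter_upwards [h] with x hx
    simp only [zero_div, ev_zero, ee0_apply, shL_pow_apply, zero_add] at hx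
    simpa [hρ.ne'] using hx
  · filter_upwards [c1, cF, (continuous_fst (X := V) (Y := ℝ)).continuousAt (x := 0) |>.eventually
      hkm'] with z h1 h2 h3
    have h4 := h2 _ h1
    rw [mul_div_cancel₀ _ hρ.ne', ← shSL_of_zero h3, ev_shS_pow h1] at h4
    have h5 : P z = _ := h4.symm
    rw [h5, div_pow]
    field_simp


section alg
open Polynomial Differential

variable {M : Type*} [CommRing M] [IsDomain M]

theorem clear1 (f : (FractionRing M)[X]) : ∃ b : M, b ≠ 0 ∧ ∃ g : M[X],
    mapRingHom (algebraMap M (FractionRing M)) g = C (algebraMap M (FractionRing M) b) * f := by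
  obtain ⟨b, hb, h⟩ := IsLocalization.integerNormalization_spec (nonZeroDivisors M) f
  refine ⟨b, nonZeroDivisors.ne_zero hb,
    IsLocalization.integerNormalization (nonZeroDivisors M) f, ?_⟩
  rw [coe_mapRingHom, h, ← Polynomial.smul_eq_C_mul, algebraMap_smul]

theorem clear2 (f f' : (FractionRing M)[X]) : ∃ b : M, b ≠ 0 ∧ ∃ g g' : M[X],
    mapRingHom (algebraMap M (FractionRing M)) g = C (algebraMap M (FractionRing M) b) * f ∧
    mapRingHom (algebraMap M (FractionRing M)) g' = C (algebraMap M (FractionRing M) b) * f' := by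
  obtain ⟨b, hb, g, hg⟩ := clear1 f
  obtain ⟨b', hb', g', hg'⟩ := clear1 f'
  refine ⟨b * b', mul_ne_zero hb hb', C b' * g, C b * g', ?_, ?_⟩
  · rw [map_mul, hg]; simp; ring
  · rw [map_mul, hg']; simp; ring

theorem alg_elim [CharZero M] [Differential M] (I : Ideal M[X]) (hI : I ≠ ⊥)
    (hrad : ∀ R : M[X], R * R ∈ I → R ∈ I)
    (hH : ∀ (R W : M[X]) (c : M), R ≠ 0 → c ≠ 0 →
      C c * mapCoeffs R = C (Differential.deriv c) * R → R * W ∈ I → C c * W ∈ I) :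
    ∃ P ∈ I, ∃ (A B : M[X]) (δ : M), δ ≠ 0 ∧
      C δ = A * P + B * (derivative P * mapCoeffs P) := by
  classical
  set K := FractionRing M
  set ι := algebraMap M K with hι
  set φ := mapRingHom ι with hφ
  have ιinj : Function.Injective ι := IsFractionRing.injective M K
  have φinj : Function.Injective φ := Polynomial.map_injective ι ιinj
  have φC : ∀ m, φ (C m) = C (ι m) := fun m => by simp [hφ]
  have uC : ∀ m : M, m ≠ 0 → IsUnit (C (ι m) : K[X]) := fun m hm =>
    Polynomial.isUnit_C.2 (isUnit_iff_ne_zero.2 ((map_ne_zero_iff ι ιinj).2 hm))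
  have φdeg : ∀ R : M[X], (φ R).degree = R.degree := fun R =>
    degree_map_eq_of_injective ιinj R
  have : CharZero K := charZero_of_injective_algebraMap ιinj
  -- minimal degree
  have hex : ∃ d : ℕ, ∃ P ∈ I, P ≠ 0 ∧ P.natDegree = d := by
    obtain ⟨P, hP, h0⟩ := Submodule.exists_mem_ne_zero_of_ne_bot hI
    exact ⟨_, P, hP, h0, rfl⟩
  obtain ⟨P, hP, hP0, hPd⟩ := Nat.find_spec hex
  have hmin : ∀ Q ∈ I, Q.degree < P.degree → Q = 0 := by
    intro Q hQ hd
    by_contra h0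
    have := natDegree_lt_natDegree h0 hd
    rw [hPd] at this
    exact Nat.find_min hex this ⟨Q, hQ, h0, rfl⟩
  set p := φ P with hp
  have hp0 : p ≠ 0 := (map_ne_zero_iff φ φinj).2 hP0
  have claim1 : ∀ Q ∈ I, p ∣ φ Q := by
    intro Q hQ
    rw [← EuclideanDomain.mod_eq_zero]
    obtain ⟨b, hb, S, hS⟩ := clear1 (φ Q / p)
    have h1 : φ (C b * Q - S * P) = C (ι b) * (φ Q % p) := by
      rw [map_sub, map_mul, map_mul, φC, hS]
      have := EuclideanDomain.div_add_mod (φ Q) p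
      rw [← hp]
      nth_rewrite 1 [← this]
      ring
    have h2 : C b * Q - S * P = 0 := by
      refine hmin _ (I.sub_mem (I.mul_mem_left _ hQ) (I.mul_mem_left _ hP)) ?_
      rw [← φdeg, h1, ← φdeg P]
      refine lt_of_le_of_lt ?_ (EuclideanDomain.mod_lt (φ Q) hp0)
      rw [degree_mul, degree_C ((map_ne_zero_iff ι ιinj).2 hb), zero_add]
    rw [h2, map_zero] at h1
    exact ((mul_eq_zero.1 h1.symm).resolve_left (uC b hb).ne_zero)
  have claim2 : p.Separable := by
    rw [PerfectField.separable_iff_squarefree]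
    rintro x ⟨y, hy⟩
    obtain ⟨b, hb, Z, Y, hZ, hY⟩ := clear2 (x * y) y
    have h1 : Z * Z = C b * (P * Y) := by
      apply φinj
      rw [map_mul, map_mul, map_mul, φC, hZ, hY, ← hp, hy]; ring
    have h2 : p ∣ φ Z := claim1 _ (hrad _ (by
      rw [h1]; exact I.mul_mem_left _ (I.mul_mem_right _ hP)))
    rw [hZ, (uC b hb).dvd_mul_left] at h2
    have hxy : x * y ≠ 0 := by
      intro h; apply hp0; rw [hy, mul_assoc, h, mul_zero]
    rw [hy, mul_assoc] at h2
    have : x * (x * y) ∣ 1 * (x * y) := by simpa using h2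
    exact isUnit_of_dvd_one ((mul_dvd_mul_iff_right hxy).1 this)
  have claim3 : IsCoprime p (φ (mapCoeffs P)) := by
    set ps := φ (mapCoeffs P) with hps
    set h := normalize (gcd p ps) with hh
    have hg0 : gcd p ps ≠ 0 := fun h => hp0 ((gcd_eq_zero_iff _ _).1 h).1
    have hm : h.Monic := monic_normalize hg0
    have hd1 : h ∣ p := (normalize_dvd_iff).2 (gcd_dvd_left _ _)
    have hd2 : h ∣ ps := (normalize_dvd_iff).2 (gcd_dvd_right _ _)
    obtain ⟨w, hw⟩ := hd1
    obtain ⟨w', hw'⟩ := hd2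
    have hcop : IsCoprime h w := by
      apply Separable.isCoprime; rw [← hw]; exact claim2
    obtain ⟨c, hc, R, hR⟩ := clear1 h
    obtain ⟨e, he, W, W', hW, hW'⟩ := clear2 w w'
    have hR0 : R ≠ 0 := by
      rintro rfl
      rw [map_zero] at hR
      exact mul_ne_zero (uC c hc).ne_zero hm.ne_zero hR.symm
    have hRW : R * W = C (c * e) * P := by
      apply φinj
      rw [map_mul, map_mul, φC, hR, hW, ← hp, hw]; simp; ring
    have hE := congrArg mapCoeffs hRW
    rw [Derivation.leibniz, Derivation.leibniz, mapCoeffs_C] at hE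
    simp only [smul_eq_mul] at hE
    have hE2 := congrArg φ hE
    simp only [map_add, map_mul φ, φC] at hE2
    rw [hR, hW, ← hps, ← hp, hw', hw, map_mul ι, map_mul C] at hE2
    set T := C c * mapCoeffs R - C (Differential.deriv c) * R with hT
    have hT0 : T = 0 := by
      have h1 : h ∣ φ T := by
        have : h ∣ φ (mapCoeffs R) * w := by
          rw [← (uC e he).dvd_mul_left]
          refine ⟨C (ι c) * C (ι e) * w' + w * C (ι (Differential.deriv (c * e)))
            - C (ι c) * φ (mapCoeffs W), ?_⟩
          linear_combination hE2
        rw [hT, map_sub, map_mul, map_mul, hR]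
        exact dvd_sub (Dvd.dvd.mul_left (hcop.dvd_of_dvd_mul_right this) _)
          (Dvd.dvd.mul_left (Dvd.dvd.mul_left dvd_rfl _) _)
      by_contra hne
      have h2 : h.degree ≤ (φ T).degree := degree_le_of_dvd h1 ((map_ne_zero_iff φ φinj).2 hne)
      have hRd : R.degree = h.degree := by
        rw [← φdeg, hR, degree_mul, degree_C ((map_ne_zero_iff ι ιinj).2 hc), zero_add]
      have hRn : R.natDegree = h.natDegree := natDegree_eq_natDegree hRd
      have hRl : R.coeff h.natDegree = c := by
        have := congrArg (fun q => coeff q h.natDegree) hR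
        simpa [hφ, hm.coeff_natDegree] using this
      rw [φdeg, degree_eq_natDegree hm.ne_zero] at h2
      have h3 : T.degree < h.natDegree := by
        rw [degree_lt_iff_coeff_zero]
        intro m hm'
        rcases hm'.eq_or_lt with rfl | hlt
        · simp [hT, hRl, mul_comm]
        · have : R.coeff m = 0 := coeff_eq_zero_of_natDegree_lt (hRn ▸ hlt)
          simp [hT, this]
      exact absurd h2 (not_le.2 h3)
    have h4 := hH R W c hR0 hc (sub_eq_zero.1 hT0) (by
      rw [hRW]; exact I.mul_mem_left _ hP)
    have h5 := claim1 _ h4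
    rw [map_mul, φC, hW, (uC c hc).dvd_mul_left, (uC e he).dvd_mul_left, hw] at h5
    have hw0 : w ≠ 0 := by rintro rfl; exact hp0 (by rw [hw, mul_zero])
    have h6 : IsUnit h := by
      have : h * w ∣ 1 * w := by simpa using h5
      exact isUnit_of_dvd_one ((mul_dvd_mul_iff_right hw0).1 this)
    rw [← gcd_isUnit_iff]
    exact (normalize_associated _).isUnit h6
  obtain ⟨a, b, hab⟩ := IsCoprime.mul_right (show IsCoprime p (derivative p) from claim2) claim3
  obtain ⟨e, he, A, B, hA, hB⟩ := clear2 a b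
  refine ⟨P, hP, A, B, e, he, ?_⟩
  apply φinj
  have hder : φ (derivative P) = derivative p := by simp [hp, hφ, derivative_map]
  rw [map_add, map_mul, map_mul, map_mul, hA, hB, φC, hder, ← hp]
  linear_combination (-C (ι e)) * hab
end alg


section germ
open Polynomial

variable (Y : Type*) [NormedAddCommGroup Y] [NormedSpace ℝ Y]

/-- ring of germs of analytic functions at the origin -/
def AGs : Subring (Germ (𝓝 (0:Y)) ℝ) where
  carrier := {γ | ∃ f : Y → ℝ, AnalyticAt ℝ f 0 ∧ (f : Germ (𝓝 (0:Y)) ℝ) = γ}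
  mul_mem' := by
    rintro _ _ ⟨f, hf, rfl⟩ ⟨g, hg, rfl⟩
    exact ⟨f * g, hf.mul hg, rfl⟩
  one_mem' := ⟨1, analyticAt_const, rfl⟩
  add_mem' := by
    rintro _ _ ⟨f, hf, rfl⟩ ⟨g, hg, rfl⟩
    exact ⟨f + g, hf.add hg, rfl⟩
  zero_mem' := ⟨0, analyticAt_const, rfl⟩
  neg_mem' := by
    rintro _ ⟨f, hf, rfl⟩
    exact ⟨-f, hf.neg, rfl⟩

def AG : Type _ := AGs Y

noncomputable instance : CommRing (AG Y) := inferInstanceAs (CommRing (AGs Y))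

variable {Y}

noncomputable def AG.rep (m : AG Y) : Y → ℝ := m.2.choose

theorem AG.rep_an (m : AG Y) : AnalyticAt ℝ m.rep 0 := m.2.choose_spec.1
theorem AG.rep_coe (m : AG Y) : (m.rep : Germ (𝓝 (0:Y)) ℝ) = m.1 := m.2.choose_spec.2

def AG.mk (f : Y → ℝ) (hf : AnalyticAt ℝ f 0) : AG Y := ⟨f, f, hf, rfl⟩

theorem AG.rep_eq {m : AG Y} {f : Y → ℝ} (h : (f : Germ (𝓝 (0:Y)) ℝ) = m.1) :
    m.rep =ᶠ[𝓝 0] f := by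
  rw [← Germ.coe_eq, AG.rep_coe, h]

theorem AG.rep_mk (f : Y → ℝ) (hf : AnalyticAt ℝ f 0) : (AG.mk f hf).rep =ᶠ[𝓝 0] f :=
  AG.rep_eq rfl

theorem AG.ext_rep {m n : AG Y} (h : m.rep =ᶠ[𝓝 0] n.rep) : m = n := by
  apply Subtype.ext
  rw [← m.rep_coe, ← n.rep_coe, Germ.coe_eq]; exact h

theorem AG.rep_add (m n : AG Y) : (m + n).rep =ᶠ[𝓝 0] m.rep + n.rep := by
  apply AG.rep_eq; rw [Germ.coe_add, m.rep_coe, n.rep_coe]; rfl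
theorem AG.rep_mul (m n : AG Y) : (m * n).rep =ᶠ[𝓝 0] m.rep * n.rep := by
  apply AG.rep_eq; rw [Germ.coe_mul, m.rep_coe, n.rep_coe]; rfl
theorem AG.rep_zero : (0 : AG Y).rep =ᶠ[𝓝 0] 0 := AG.rep_eq rfl
theorem AG.rep_one : (1 : AG Y).rep =ᶠ[𝓝 0] 1 := AG.rep_eq rfl

theorem AG.eq_zero {m : AG Y} (h : ∀ᶠ y in 𝓝 (0:Y), m.rep y = 0) : m = 0 :=
  AG.ext_rep ((show m.rep =ᶠ[𝓝 0] 0 from h).trans AG.rep_zero.symm)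

theorem AG.eq_zero_iff {m : AG Y} : m = 0 ↔ ∀ᶠ y in 𝓝 (0:Y), m.rep y = 0 :=
  ⟨fun h => by rw [h]; exact AG.rep_zero, AG.eq_zero⟩

instance : Nontrivial (AG Y) := ⟨0, 1, fun h => by
  have h1 : (0 : AG Y).rep =ᶠ[𝓝 0] (1 : AG Y).rep := by rw [h]
  have := (AG.rep_zero.symm.trans (h1.trans AG.rep_one)).self_of_nhds
  simp at this⟩

instance : NoZeroDivisors (AG Y) where
  eq_zero_or_eq_zero_of_mul_eq_zero := by
    intro m n h
    by_contra! hc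
    obtain ⟨r, hr, hm⟩ := an_ball m.rep_an
    have hn0 : ∃ᶠ y in 𝓝 (0:Y), n.rep y ≠ 0 := by
      exact fun h => hc.2 (AG.eq_zero (h.mono fun y hy => not_not.1 hy))
    have h1 := (AG.rep_mul m n).symm.trans (AG.eq_zero_iff.1 h : (m * n).rep =ᶠ[𝓝 0] 0)
    have h1' := (eventually_eventually_nhds.2 h1)
    have h3 := hn0.and_eventually (((h1'.and n.rep_an.eventually_analyticAt)).and
      (ball_mem_nhds (0:Y) hr))
    obtain ⟨y, hy0, ⟨hy1, hy2⟩, hy3⟩ := h3.exists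
    have h4 : ∀ᶠ z in 𝓝 y, m.rep z = 0 := by
      filter_upwards [hy1, hy2.continuousAt.eventually_ne hy0] with z hz1 hz2
      exact (mul_eq_zero.1 hz1).resolve_right hz2
    have h5 := an_zero_ball hm hy3 h4
    refine hc.1 (AG.eq_zero ?_)
    filter_upwards [ball_mem_nhds (0:Y) hr] with z hz using h5 z hz

instance : IsDomain (AG Y) := NoZeroDivisors.to_isDomain _

def AG.const : ℝ →+* AG Y where
  toFun a := AG.mk (fun _ => a) analyticAt_const
  map_one' := rfl
  map_mul' _ _ := rfl
  map_zero' := rfl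
  map_add' _ _ := rfl

instance : CharZero (AG Y) := charZero_of_injective_ringHom (AG.const (Y := Y)).injective

variable {X : Type*} [NormedAddCommGroup X] [NormedSpace ℝ X]

theorem an_ds {f : X × ℝ → ℝ} {y : X × ℝ} (hf : AnalyticAt ℝ f y) :
    AnalyticAt ℝ (fun y => fderiv ℝ f y (0, 1)) y :=
  ((ContinuousLinearMap.apply ℝ ℝ ((0, 1) : X × ℝ)).analyticAt _).fun_comp hf.fderiv

noncomputable def AG.ds (m : AG (X × ℝ)) : AG (X × ℝ) :=
  AG.mk (fun y => fderiv ℝ m.rep y (0, 1)) (an_ds m.rep_an)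

theorem AG.rep_ds' {m : AG (X × ℝ)} {f : X × ℝ → ℝ} (h : m.rep =ᶠ[𝓝 0] f) :
    m.ds.rep =ᶠ[𝓝 0] fun y => fderiv ℝ f y (0, 1) := by
  refine (AG.rep_mk _ _).trans ?_
  filter_upwards [eventually_eventually_nhds.2 h] with y hy
  rw [Filter.EventuallyEq.fderiv_eq hy]

theorem AG.rep_ds (m : AG (X × ℝ)) :
    m.ds.rep =ᶠ[𝓝 0] fun y => fderiv ℝ m.rep y (0, 1) := AG.rep_mk _ _

noncomputable instance : Differential (AG (X × ℝ)) where
  deriv := Derivation.mk' (AddMonoidHom.toIntLinearMap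
    { toFun := AG.ds
      map_zero' := AG.ext_rep (by
        refine (AG.rep_ds' AG.rep_zero).trans (Filter.EventuallyEq.trans ?_ AG.rep_zero.symm)
        refine Filter.Eventually.of_forall fun y => ?_
        simp)
      map_add' := fun m n => AG.ext_rep (by
        refine (AG.rep_ds' (AG.rep_add m n)).trans ?_
        refine Filter.EventuallyEq.trans ?_ (AG.rep_add _ _).symm
        filter_upwards [m.rep_ds, n.rep_ds, m.rep_an.eventually_analyticAt,
          n.rep_an.eventually_analyticAt] with y h1 h2 h3 h4
        rw [fderiv_add h3.differentiableAt h4.differentiableAt, Pi.add_apply, h1, h2]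
        rfl) }) (fun m n => AG.ext_rep (by
        refine (AG.rep_ds' (AG.rep_mul m n)).trans ?_
        refine Filter.EventuallyEq.trans ?_ (AG.rep_add _ _).symm
        filter_upwards [m.rep_ds, n.rep_ds, m.rep_an.eventually_analyticAt,
          n.rep_an.eventually_analyticAt, AG.rep_mul m n.ds, AG.rep_mul n m.ds]
          with y h1 h2 h3 h4 h5 h6
        rw [fderiv_mul h3.differentiableAt h4.differentiableAt, Pi.add_apply]
        change _ = (m * n.ds).rep y + (n * m.ds).rep y
        rw [h5, h6, Pi.mul_apply, Pi.mul_apply, h1, h2]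
        rfl))

theorem AG.deriv_eq (m : AG (X × ℝ)) : Differential.deriv m = m.ds := rfl

noncomputable def AG.toPolyGerm : AG Y →+* Germ (𝓝 (0:Y)) ℝ[X] where
  toFun m := ((fun y => C (m.rep y) : Y → ℝ[X]) : Germ (𝓝 (0:Y)) ℝ[X])
  map_one' := by
    rw [← Germ.coe_one, Germ.coe_eq]
    filter_upwards [AG.rep_one (Y := Y)] with y hy
    simp [hy]
  map_mul' m n := by
    rw [← Germ.coe_mul, Germ.coe_eq]
    filter_upwards [AG.rep_mul m n] with y hy
    simp [hy]
  map_zero' := by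
    rw [← Germ.coe_zero, Germ.coe_eq]
    filter_upwards [AG.rep_zero (Y := Y)] with y hy
    simp [hy]
  map_add' m n := by
    rw [← Germ.coe_add, Germ.coe_eq]
    filter_upwards [AG.rep_add m n] with y hy
    simp [hy]

noncomputable def AG.Psi : (AG Y)[X] →+* Germ (𝓝 (0:Y)) ℝ[X] :=
  eval₂RingHom AG.toPolyGerm ((fun _ => Polynomial.X : Y → ℝ[X]) : Germ (𝓝 (0:Y)) ℝ[X])

noncomputable def pe (R : (AG Y)[X]) (y : Y) : ℝ[X] :=
  ∑ i ∈ Finset.range (R.natDegree + 1), C ((R.coeff i).rep y) * Polynomial.X ^ i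

theorem pe_coe (R : (AG Y)[X]) : ((pe R : Y → ℝ[X]) : Germ (𝓝 (0:Y)) ℝ[X]) = AG.Psi R := by
  have h1 : pe R = ∑ i ∈ Finset.range (R.natDegree + 1),
      (fun y => C ((R.coeff i).rep y)) * (fun _ => Polynomial.X) ^ i := by
    funext y; simp [pe]
  rw [h1, AG.Psi, coe_eval₂RingHom, eval₂_eq_sum_range]
  exact map_sum (Germ.coeRingHom (𝓝 (0:Y))) _ _

theorem pe_add (R S : (AG Y)[X]) : ∀ᶠ y in 𝓝 (0:Y), pe (R + S) y = pe R y + pe S y := by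
  have : ((pe (R + S) : Y → ℝ[X]) : Germ (𝓝 (0:Y)) ℝ[X]) = ((pe R + pe S : Y → ℝ[X]) : Germ _ _) := by
    rw [Germ.coe_add, pe_coe, pe_coe, pe_coe, map_add]
  exact Germ.coe_eq.1 this

theorem pe_mul (R S : (AG Y)[X]) : ∀ᶠ y in 𝓝 (0:Y), pe (R * S) y = pe R y * pe S y := by
  have : ((pe (R * S) : Y → ℝ[X]) : Germ (𝓝 (0:Y)) ℝ[X]) = ((pe R * pe S : Y → ℝ[X]) : Germ _ _) := by
    rw [Germ.coe_mul, pe_coe, pe_coe, pe_coe, map_mul]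
  exact Germ.coe_eq.1 this

theorem pe_C (m : AG Y) (y : Y) : pe (C m) y = C (m.rep y) := by
  simp [pe]

theorem pe_eval (R : (AG Y)[X]) (y : Y) (t : ℝ) : (pe R y).eval t =
    ∑ i ∈ Finset.range (R.natDegree + 1), (R.coeff i).rep y * t ^ i := by
  simp [pe, eval_finsetSum]

theorem pe_coeff (R : (AG Y)[X]) (y : Y) (i : ℕ) (hi : i ≤ R.natDegree) :
    (pe R y).coeff i = (R.coeff i).rep y := by
  simp [pe, finsetSum_coeff, coeff_C_mul, coeff_X_pow]
  intro h; omega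

theorem pe_eq_of_Psi {R : (AG Y)[X]} {f : Y → ℝ[X]} (h : AG.Psi R = (f : Germ (𝓝 (0:Y)) ℝ[X])) :
    ∀ᶠ y in 𝓝 (0:Y), pe R y = f y := by
  rw [← pe_coe] at h; exact Germ.coe_eq.1 h

theorem Psi_C (m : AG Y) : AG.Psi (C m) = ((fun y => C (m.rep y) : Y → ℝ[X]) : Germ (𝓝 (0:Y)) ℝ[X]) := by
  rw [AG.Psi, coe_eval₂RingHom, eval₂_C]; rfl

theorem Psi_X : AG.Psi (Polynomial.X : (AG Y)[X]) = ((fun _ => Polynomial.X : Y → ℝ[X]) : Germ (𝓝 (0:Y)) ℝ[X]) := by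
  rw [AG.Psi, coe_eval₂RingHom, eval₂_X]

theorem pe_monomial (n : ℕ) (a : AG Y) :
    ∀ᶠ y in 𝓝 (0:Y), pe (monomial n a) y = monomial n (a.rep y) := by
  have : AG.Psi (monomial n a) = ((fun y => C (a.rep y) * Polynomial.X ^ n : Y → ℝ[X]) : Germ (𝓝 (0:Y)) ℝ[X]) := by
    rw [← C_mul_X_pow_eq_monomial, map_mul, map_pow, Psi_C, Psi_X]; rfl
  filter_upwards [pe_eq_of_Psi this] with y hy
  rw [hy, C_mul_X_pow_eq_monomial]

theorem AG.rep_natCast (n : ℕ) : (n : AG Y).rep =ᶠ[𝓝 0] fun _ => (n : ℝ) := by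
  have : (n : AG Y) = AG.const (n : ℝ) := (map_natCast AG.const n).symm
  rw [this]; exact AG.rep_mk _ analyticAt_const

theorem pe_derivative (R : (AG Y)[X]) :
    ∀ᶠ y in 𝓝 (0:Y), pe (derivative R) y = derivative (pe R y) := by
  induction R using Polynomial.induction_on' with
  | add p q hp hq =>
    rw [derivative_add]
    filter_upwards [hp, hq, pe_add p q, pe_add (derivative p) (derivative q)] with y h1 h2 h3 h4
    rw [h4, h3, h1, h2, derivative_add]
  | monomial n a =>
    rw [derivative_monomial]
    filter_upwards [pe_monomial n a, pe_monomial (n - 1) (a * (n : AG Y)), AG.rep_mul a (n : AG Y),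
      AG.rep_natCast (Y := Y) n] with y h1 h2 h3 h4
    rw [h2, h1, derivative_monomial, h3, Pi.mul_apply, h4]

theorem pe_ds (R : (AG (X × ℝ))[X]) : ∀ᶠ y in 𝓝 (0 : X × ℝ), ∀ t : ℝ,
    HasDerivAt (fun s => (pe R (y.1, s)).eval t) ((pe (Differential.mapCoeffs R) y).eval t) y.2 := by
  have hc : ∀ y : X × ℝ, Tendsto (fun s : ℝ => (y.1, s)) (𝓝 y.2) (𝓝 y) := fun y => by
    have : Continuous (fun s : ℝ => (y.1, s)) := by fun_prop
    exact this.tendsto y.2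
  induction R using Polynomial.induction_on' with
  | add p q hp hq =>
    rw [map_add]
    filter_upwards [hp, hq, eventually_eventually_nhds.2 (pe_add p q),
      pe_add (Differential.mapCoeffs p) (Differential.mapCoeffs q)] with y h1 h2 h3 h4 t
    rw [h4, eval_add]
    refine ((h1 t).add (h2 t)).congr_of_eventuallyEq ?_
    filter_upwards [(hc y).eventually h3] with s hs
    rw [hs, eval_add]; rfl
  | monomial n a =>
    rw [Differential.mapCoeffs_monomial]
    filter_upwards [eventually_eventually_nhds.2 (pe_monomial n a),
      pe_monomial n (Differential.deriv a), AG.rep_ds a, a.rep_an.eventually_analyticAt]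
      with y h1 h2 h3 h4 t
    rw [h2, eval_monomial, AG.deriv_eq, h3]
    have k1 : HasDerivAt (fun s : ℝ => (y.1, s)) ((0:X), (1:ℝ)) y.2 :=
      (hasDerivAt_const _ _).prodMk (hasDerivAt_id _)
    have k2 : HasDerivAt (fun s : ℝ => a.rep (y.1, s)) (fderiv ℝ a.rep y (0, 1)) y.2 :=
      HasFDerivAt.comp_hasDerivAt (f := fun s : ℝ => (y.1, s)) y.2 h4.differentiableAt.hasFDerivAt k1
    refine (k2.mul_const (t ^ n)).congr_of_eventuallyEq ?_
    filter_upwards [(hc y).eventually h1] with s hs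
    rw [hs, eval_monomial]

theorem pe_an (R : (AG Y)[X]) : ∀ᶠ y in 𝓝 (0 : Y), ∀ t : ℝ,
    AnalyticAt ℝ (fun z : Y × ℝ => (pe R z.1).eval z.2) (y, t) := by
  have := (Finset.eventually_all (Finset.range (R.natDegree + 1)) (l := 𝓝 (0:Y))
      (p := fun j x => AnalyticAt ℝ (R.coeff j).rep x)).2
      (fun j _ => (R.coeff j).rep_an.eventually_analyticAt)
  filter_upwards [this] with y hy t
  simp only [pe_eval]
  refine Finset.analyticAt_fun_sum _ fun i hi => ?_
  refine AnalyticAt.mul ?_ (analyticAt_snd.pow i)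
  exact AnalyticAt.fun_comp (g := (R.coeff i).rep) (hy i hi) analyticAt_fst

end germ


theorem loc_min {φ : ℝ × ℝ → ℝ} {γ : ℝ → ℝ} {τ a b : ℝ}
    (hφ : DifferentiableAt ℝ φ (γ τ, τ)) (ha : HasDerivAt (fun s => φ (s, τ)) a (γ τ))
    (hb : HasDerivAt (fun t => φ (γ τ, t)) b τ) (hγ : ContinuousAt γ τ)
    (hm : IsLocalMin γ τ) (h0 : ∀ᶠ t in 𝓝 τ, φ (γ t, t) = 0) : a = 0 ∨ b = 0 := by
  by_contra! hc
  have hL := hφ.hasFDerivAt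
  set L := fderiv ℝ φ (γ τ, τ) with hLd
  have k1 : HasDerivAt (fun s : ℝ => (s, τ)) ((1:ℝ), (0:ℝ)) (γ τ) :=
    (hasDerivAt_id _).prodMk (hasDerivAt_const _ _)
  have k2 : HasDerivAt (fun t : ℝ => (γ τ, t)) ((0:ℝ), (1:ℝ)) τ :=
    (hasDerivAt_const _ _).prodMk (hasDerivAt_id _)
  have La : L (1, 0) = a :=
    (HasFDerivAt.comp_hasDerivAt (f := fun s : ℝ => (s, τ)) (γ τ) hL k1).unique ha
  have Lb : L (0, 1) = b :=
    (HasFDerivAt.comp_hasDerivAt (f := fun t : ℝ => (γ τ, t)) τ hL k2).unique hb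
  have Lz : ∀ u v : ℝ, L (u, v) = a * u + b * v := by
    intro u v
    have : ((u, v) : ℝ × ℝ) = u • (1, 0) + v • (0, 1) := by simp
    rw [this, map_add, map_smul, map_smul, La, Lb]; simp; ring
  have hε : 0 < min |a| |b| / 2 := by
    have := lt_min (abs_pos.2 hc.1) (abs_pos.2 hc.2); linarith
  have hlo := (hasFDerivAt_iff_isLittleO.1 hL).def hε
  have hcont : ContinuousAt (fun t => (γ t, t)) τ := hγ.prodMk continuousAt_id
  have h1 := hcont.eventually hlo
  have h00 := h0.self_of_nhds
  obtain ⟨η, hη, hball⟩ := Metric.eventually_nhds_iff.1 ((h1.and h0).and hm)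
  obtain ⟨σ, hσ, hσs⟩ : ∃ σ : ℝ, |σ| = 1 ∧ 0 ≤ a * b * σ := by
    rcases le_total 0 (a * b) with h | h
    · exact ⟨1, by simp, by simpa using h⟩
    · exact ⟨-1, by simp, by linarith⟩
  obtain ⟨⟨h2, h3⟩, h4⟩ := hball (y := τ + σ * (η / 2)) (by
    rw [Real.dist_eq, add_sub_cancel_left, abs_mul, hσ, one_mul, abs_of_pos (by linarith)]
    linarith)
  set t := τ + σ * (η / 2) with ht
  rw [h3, h00, sub_zero, zero_sub, norm_neg, Prod.mk_sub_mk, Lz] at h2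
  have hs : 0 ≤ γ t - γ τ := sub_nonneg.2 h4
  have hnorm : ‖((γ t - γ τ, t - τ) : ℝ × ℝ)‖ ≤ (γ t - γ τ) + η / 2 := by
    refine (norm_prod_le_iff).2 ⟨?_, ?_⟩
    · rw [Real.norm_eq_abs, abs_of_nonneg hs]; linarith
    · rw [Real.norm_eq_abs, ht, add_sub_cancel_left, abs_mul, hσ, one_mul,
        abs_of_pos (by linarith)]; linarith
  have hlow : |a| * (γ t - γ τ) + |b| * (η / 2) ≤ ‖a * (γ t - γ τ) + b * (t - τ)‖ := by
    have e1 : |a * (γ t - γ τ) + b * (t - τ)| = |a * (γ t - γ τ)| + |b * (t - τ)| := by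
      rw [abs_add_eq_add_abs_iff]
      have : 0 ≤ (a * (γ t - γ τ)) * (b * (t - τ)) := by
        rw [ht, add_sub_cancel_left]
        have : 0 ≤ (a * b * σ) * ((γ t - γ τ) * (η / 2)) := by positivity
        linarith
      exact mul_nonneg_iff.1 this
    rw [Real.norm_eq_abs, e1, abs_mul, abs_mul, abs_of_nonneg hs, ht, add_sub_cancel_left, abs_mul,
      hσ, one_mul, abs_of_pos (show 0 < η / 2 by linarith)]
  have h5 := hlow.trans (h2.trans (mul_le_mul_of_nonneg_left hnorm hε.le))
  have h6 : min |a| |b| ≤ |a| := min_le_left _ _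
  have h7 : min |a| |b| ≤ |b| := min_le_right _ _
  nlinarith

section elim
open Polynomial
variable {X : Type*} [NormedAddCommGroup X] [NormedSpace ℝ X]

theorem gr_tendsto {g : X × ℝ → ℝ} (hg : Continuous g) (z : X × ℝ) :
    Tendsto (fun z : X × ℝ => (z.1, g z)) (𝓝 z) (𝓝 (z.1, g z)) := by
  have : Continuous (fun z : X × ℝ => (z.1, g z)) := by fun_prop
  exact this.tendsto z

theorem gr_tendsto0 {g : X × ℝ → ℝ} (hg : Continuous g) (g0 : g 0 = 0) :
    Tendsto (fun z : X × ℝ => (z.1, g z)) (𝓝 0) (𝓝 0) := by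
  have := gr_tendsto hg 0
  rw [g0] at this
  exact this

def graphIdeal (g : X × ℝ → ℝ) (hg : Continuous g) (g0 : g 0 = 0) : Ideal (AG (X × ℝ))[X] where
  carrier := {R | ∀ᶠ z in 𝓝 (0 : X × ℝ), (pe R (z.1, g z)).eval z.2 = 0}
  add_mem' := by
    intro R S hR hS
    filter_upwards [hR, hS, (gr_tendsto0 hg g0).eventually (pe_add R S)] with z h1 h2 h3
    rw [h3, eval_add, h1, h2, add_zero]
  zero_mem' := by
    filter_upwards [(gr_tendsto0 hg g0).eventually (pe_monomial 0 (0 : AG (X × ℝ))),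
      (gr_tendsto0 hg g0).eventually (AG.rep_zero (Y := X × ℝ))] with z h1 h2
    rw [monomial_zero_right] at h1
    rw [h1, h2]; simp
  smul_mem' := by
    intro R S hS
    filter_upwards [hS, (gr_tendsto0 hg g0).eventually (pe_mul R S)] with z h1 h2
    rw [smul_eq_mul, h2, eval_mul, h1, mul_zero]

theorem mem_graphIdeal {g : X × ℝ → ℝ} {hg : Continuous g} {g0 : g 0 = 0} {R : (AG (X × ℝ))[X]} :
    R ∈ graphIdeal g hg g0 ↔ ∀ᶠ z in 𝓝 (0 : X × ℝ), (pe R (z.1, g z)).eval z.2 = 0 := Iff.rfl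

theorem graph_hH (g : X × ℝ → ℝ) (hg : Continuous g) (g0 : g 0 = 0) (R W : (AG (X × ℝ))[X])
    (c : AG (X × ℝ)) (hR : R ≠ 0)
    (hcR : C c * Differential.mapCoeffs R = C (Differential.deriv c) * R)
    (hRW : R * W ∈ graphIdeal g hg g0) : C c * W ∈ graphIdeal g hg g0 := by
  rw [mem_graphIdeal] at hRW ⊢
  have G := gr_tendsto0 hg g0
  have hcoef : ∀ i, c * (R.coeff i).ds = c.ds * R.coeff i := by
    intro i
    have := congrArg (fun q => coeff q i) hcR
    simp only [coeff_C_mul, Differential.coeff_mapCoeffs] at this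
    exact this
  -- a good ball
  have hgood : ∀ᶠ y in 𝓝 (0 : X × ℝ), AnalyticAt ℝ c.rep y ∧
      ∀ i ∈ Finset.range (R.natDegree + 1), AnalyticAt ℝ (R.coeff i).rep y ∧
        c.rep y * fderiv ℝ (R.coeff i).rep y (0, 1) = fderiv ℝ c.rep y (0, 1) * (R.coeff i).rep y := by
    refine c.rep_an.eventually_analyticAt.and ((Finset.eventually_all _).2 fun i _ => ?_)
    refine (R.coeff i).rep_an.eventually_analyticAt.and ?_
    have e1 : (c * (R.coeff i).ds).rep =ᶠ[𝓝 0] (c.ds * R.coeff i).rep := by rw [hcoef i]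
    filter_upwards [e1, AG.rep_mul c (R.coeff i).ds, AG.rep_mul c.ds (R.coeff i),
      (R.coeff i).rep_ds, c.rep_ds] with y h1 h2 h3 h4 h5
    rw [h2, h3, Pi.mul_apply, Pi.mul_apply, h4, h5] at h1
    exact h1
  obtain ⟨r, hr, hball⟩ := Metric.eventually_nhds_iff_ball.1 hgood
  have hgr := G.eventually (ball_mem_nhds (0 : X × ℝ) hr)
  have hz := (hRW.and (G.eventually (pe_mul R W))).and
    (hgr.and (G.eventually (pe_an W)))
  filter_upwards [eventually_eventually_nhds.2 hz, G.eventually (pe_mul (C c) W)] with z0 hz0 hz0'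
  rw [hz0', eval_mul, pe_C, eval_C]
  by_contra hne
  obtain ⟨⟨-, -⟩, hz0r, hz0W⟩ := hz0.self_of_nhds
  have hcne : c.rep (z0.1, g z0) ≠ 0 := left_ne_zero_of_mul hne
  have hWne : (pe W (z0.1, g z0)).eval z0.2 ≠ 0 := right_ne_zero_of_mul hne
  -- near z0, R vanishes on the graph
  have hRz : ∀ᶠ z in 𝓝 z0, (pe R (z.1, g z)).eval z.2 = 0 := by
    have hWc : Tendsto (fun z : X × ℝ => (pe W (z.1, g z)).eval z.2) (𝓝 z0)
        (𝓝 ((pe W (z0.1, g z0)).eval z0.2)) := by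
      have t1 : Tendsto (fun z : X × ℝ => ((z.1, g z), z.2)) (𝓝 z0) (𝓝 ((z0.1, g z0), z0.2)) := by
        have : Continuous (fun z : X × ℝ => ((z.1, g z), z.2)) := by fun_prop
        exact this.tendsto z0
      exact (hz0W z0.2).continuousAt.tendsto.comp t1
    filter_upwards [hz0, hWc.eventually_ne hWne] with z h1 h2
    obtain ⟨⟨h3, h4⟩, -⟩ := h1
    rw [h4, eval_mul] at h3
    exact (mul_eq_zero.1 h3).resolve_right h2
  -- a box
  set y0 : X × ℝ := (z0.1, g z0) with hy0
  have hbox : ∀ᶠ y in 𝓝 y0, y ∈ ball (0 : X × ℝ) r ∧ c.rep y ≠ 0 :=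
    Filter.Eventually.and (isOpen_ball.mem_nhds hz0r)
      ((hball y0 hz0r).1.continuousAt.eventually_ne hcne)
  obtain ⟨η, hη, hbox⟩ := Metric.eventually_nhds_iff_ball.1 hbox
  have hzz := hRz.and ((gr_tendsto hg z0).eventually (ball_mem_nhds y0 hη))
  obtain ⟨κ, hκ, hzz⟩ := Metric.eventually_nhds_iff_ball.1 hzz
  have hconst : ∀ x s s', (x, s) ∈ ball y0 η → (x, s') ∈ ball y0 η →
      ∀ i ∈ Finset.range (R.natDegree + 1),
      (R.coeff i).rep (x, s) / c.rep (x, s) = (R.coeff i).rep (x, s') / c.rep (x, s') := by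
    intro x s s' hs hs' i hi
    have hmem : ∀ u, (x, u) ∈ ball y0 η ↔ dist x y0.1 < η ∧ u ∈ ball y0.2 η := by
      intro u; rw [mem_ball, Prod.dist_eq, max_lt_iff]; rfl
    have hx := ((hmem s).1 hs).1
    have hd : ∀ u ∈ ball y0.2 η,
        HasDerivAt (fun u => (R.coeff i).rep (x, u) / c.rep (x, u)) 0 u := by
      intro u hu
      obtain ⟨hb1, hb2⟩ := hbox (x, u) ((hmem u).2 ⟨hx, hu⟩)
      obtain ⟨hb3, hb4⟩ := hball _ hb1
      obtain ⟨hb5, hb6⟩ := hb4 i hi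
      have k1 : HasDerivAt (fun s : ℝ => (x, s)) ((0:X), (1:ℝ)) u :=
        (hasDerivAt_const _ _).prodMk (hasDerivAt_id _)
      have k2 := HasFDerivAt.comp_hasDerivAt (f := fun s : ℝ => (x, s)) u
        hb5.differentiableAt.hasFDerivAt k1
      have k3 := HasFDerivAt.comp_hasDerivAt (f := fun s : ℝ => (x, s)) u
        hb3.differentiableAt.hasFDerivAt k1
      refine (k2.div k3 hb2).congr_deriv ?_
      rw [div_eq_zero_iff]; left
      simp only [Function.comp]
      linear_combination hb6
    exact isOpen_ball.is_const_of_deriv_eq_zero (convex_ball y0.2 η).isPreconnected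
      (fun u hu => (hd u hu).differentiableAt.differentiableWithinAt)
      (fun u hu => (hd u hu).deriv) ((hmem s).1 hs).2 ((hmem s').1 hs').2
  have hvan : ∀ y ∈ ball y0 (min η κ), ∀ i ∈ Finset.range (R.natDegree + 1),
      (R.coeff i).rep y = 0 := by
    rintro ⟨x, s⟩ hy i hi
    have hyη : (x, s) ∈ ball y0 η := ball_subset_ball (min_le_left _ _) hy
    have hyκ : (x, s) ∈ ball y0 κ := ball_subset_ball (min_le_right _ _) hy
    have hxκ : dist x z0.1 < κ := by
      rw [mem_ball, Prod.dist_eq, max_lt_iff] at hyκ; exact hyκ.1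
    have hroots : ∀ t ∈ ball z0.2 κ, (pe R (x, s)).eval t = 0 := by
      intro t ht
      obtain ⟨h1, h2⟩ := hzz (x, t) (by
        rw [mem_ball, Prod.dist_eq, max_lt_iff]; exact ⟨hxκ, ht⟩)
      have e1 : ∀ u, (x, u) ∈ ball y0 η → (pe R (x, u)).eval t = c.rep (x, u) *
          ∑ j ∈ Finset.range (R.natDegree + 1),
            (R.coeff j).rep (x, s) / c.rep (x, s) * t ^ j := by
        intro u hu
        rw [pe_eval, Finset.mul_sum]
        refine Finset.sum_congr rfl fun j hj => ?_
        rw [hconst x s u hyη hu j hj]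
        have := (hbox _ hu).2
        field_simp
      have e2 := e1 _ h2
      rw [h1] at e2
      have e3 := (mul_eq_zero.1 e2.symm).resolve_left (hbox _ h2).2
      rw [e1 s hyη, e3, mul_zero]
    have hp0 : pe R (x, s) = 0 := by
      refine eq_zero_of_infinite_isRoot _ (Set.Infinite.mono (s := ball z0.2 κ) hroots ?_)
      rw [Real.ball_eq_Ioo]
      exact Set.Ioo_infinite (by linarith)
    rw [← pe_coeff R (x, s) i (Nat.lt_succ_iff.1 (Finset.mem_range.1 hi)), hp0, coeff_zero]
  apply hR
  refine Polynomial.ext fun i => ?_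
  rw [coeff_zero]
  by_cases hi : i ∈ Finset.range (R.natDegree + 1)
  · have h1 : AnalyticOnNhd ℝ (R.coeff i).rep (ball 0 r) := fun y hy => ((hball y hy).2 i hi).1
    have h2 : ∀ᶠ y in 𝓝 y0, (R.coeff i).rep y = 0 := by
      filter_upwards [ball_mem_nhds y0 (lt_min hη hκ)] with y hy using hvan y hy i hi
    have h3 := an_zero_ball h1 hz0r h2
    apply AG.eq_zero
    filter_upwards [ball_mem_nhds (0 : X × ℝ) hr] with y hy using h3 y hy
  · exact coeff_eq_zero_of_natDegree_lt (by simpa using hi)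

theorem elim_lemma (g : X × ℝ → ℝ) (hg : Continuous g) (g0 : g 0 = 0) (d : ℕ)
    (a : Fin d → X × ℝ → ℝ) (ha : ∀ i, AnalyticAt ℝ (a i) 0)
    (hv : ∀ᶠ z in 𝓝 (0 : X × ℝ), z.2 ^ d + ∑ i : Fin d, a i (z.1, g z) * z.2 ^ (i:ℕ) = 0) :
    ∃ δ : X × ℝ → ℝ, AnalyticAt ℝ δ 0 ∧ (¬ ∀ᶠ y in 𝓝 (0 : X × ℝ), δ y = 0) ∧
      ∀ᶠ z in 𝓝 (0 : X × ℝ), IsLocalMin (fun t => g (z.1, t)) z.2 → δ (z.1, g z) = 0 := by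
  have G := gr_tendsto0 hg g0
  have hI : graphIdeal g hg g0 ≠ ⊥ := by
    let S : (AG (X × ℝ))[X] := ∑ i : Fin d, C (AG.mk (a i) (ha i)) * Polynomial.X ^ (i:ℕ)
    let P0 : (AG (X × ℝ))[X] := Polynomial.X ^ d + S
    have hmon : P0.Monic := monic_X_pow_add (degree_sum_fin_lt _)
    have hPsi : AG.Psi P0 = ((fun y => Polynomial.X ^ d + ∑ i : Fin d,
        C ((AG.mk (a i) (ha i)).rep y) * Polynomial.X ^ (i:ℕ) : X × ℝ → ℝ[X]) :
          Germ (𝓝 (0:X × ℝ)) ℝ[X]) := by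
      have e : (fun y => Polynomial.X ^ d + ∑ i : Fin d,
        C ((AG.mk (a i) (ha i)).rep y) * Polynomial.X ^ (i:ℕ) : X × ℝ → ℝ[X]) =
        (fun _ => Polynomial.X) ^ d + ∑ i : Fin d, (fun y => C ((AG.mk (a i) (ha i)).rep y)) *
          (fun _ => Polynomial.X) ^ (i:ℕ) := by
        funext y; simp
      rw [e]
      simp only [P0, S, map_add, map_sum, map_mul, map_pow, Psi_C, Psi_X]
      have k := map_sum (Germ.coeRingHom (𝓝 (0:X × ℝ))) (fun i : Fin d =>
        ((fun y => C ((AG.mk (a i) (ha i)).rep y)) *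
          (fun _ => Polynomial.X) ^ (i:ℕ) : X × ℝ → ℝ[X])) Finset.univ
      rw [Germ.coe_add]
      exact congrArg₂ (· + ·) rfl k.symm
    intro hbot
    have hmem : P0 ∈ graphIdeal g hg g0 := by
      rw [mem_graphIdeal]
      have hall : ∀ᶠ y in 𝓝 (0 : X × ℝ), ∀ i, (AG.mk (a i) (ha i)).rep y = a i y :=
        Filter.eventually_all.2 fun i => AG.rep_mk _ _
      filter_upwards [hv, G.eventually (pe_eq_of_Psi hPsi), G.eventually hall] with z h1 h2 h3
      rw [h2]
      simp only [h3]
      simpa [eval_finsetSum] using h1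
    rw [hbot, Ideal.mem_bot] at hmem
    exact hmon.ne_zero hmem
  obtain ⟨P, hP, A, B, δ, hδ, hE⟩ := alg_elim (graphIdeal g hg g0) hI
    (by
      intro R hR
      rw [mem_graphIdeal] at hR ⊢
      filter_upwards [hR, G.eventually (pe_mul R R)] with z h1 h2
      rw [h2, eval_mul] at h1
      exact mul_self_eq_zero.1 h1)
    (fun R W c hR _ hcR hRW => graph_hH g hg g0 R W c hR hcR hRW)
  refine ⟨δ.rep, δ.rep_an, fun h => hδ (AG.eq_zero h), ?_⟩
  have e1 := pe_add (A * P) (B * (derivative P * Differential.mapCoeffs P))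
  rw [← hE] at e1
  rw [mem_graphIdeal] at hP
  filter_upwards [eventually_eventually_nhds.2 hP, G.eventually e1, G.eventually (pe_mul A P),
    G.eventually (pe_mul B (derivative P * Differential.mapCoeffs P)),
    G.eventually (pe_mul (derivative P) (Differential.mapCoeffs P)),
    G.eventually (pe_derivative P), G.eventually (pe_ds P), G.eventually (pe_an P)]
    with z h0 h1 h2 h3 h4 h5 h6 h7 hmin
  have h8 := congrArg (fun q => eval z.2 q) h1
  simp only [pe_C, eval_C, h2, h3, h4, h5, eval_add, eval_mul, h0.self_of_nhds] at h8
  rw [h8]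
  have k := loc_min (φ := fun q : ℝ × ℝ => (pe P (z.1, q.1)).eval q.2)
    (γ := fun t => g (z.1, t)) (τ := z.2) (a := (pe (Differential.mapCoeffs P) (z.1, g z)).eval z.2)
    (b := (derivative (pe P (z.1, g z))).eval z.2) ?_ (h6 z.2) ?_ ?_ hmin ?_
  · rcases k with k | k <;> rw [k] <;> ring
  · have t1 : DifferentiableAt ℝ (fun q : ℝ × ℝ => ((z.1, q.1), q.2)) (g (z.1, z.2), z.2) := by
      fun_prop
    exact DifferentiableAt.comp (g := fun w : (X × ℝ) × ℝ => (pe P w.1).eval w.2)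
      (f := fun q : ℝ × ℝ => ((z.1, q.1), q.2)) (g (z.1, z.2), z.2)
      (h7 z.2).differentiableAt t1
  · exact (pe P (z.1, g z)).hasDerivAt z.2
  · have : Continuous (fun t => g (z.1, t)) := by fun_prop
    exact this.continuousAt
  · have : Tendsto (fun t : ℝ => (z.1, t)) (𝓝 z.2) (𝓝 z) := by
      have : Continuous (fun t : ℝ => (z.1, t)) := by fun_prop
      exact this.tendsto z.2
    exact this.eventually h0

end elim


theorem real_lem {c1 c2 D : ℝ} (h1 : 0 < c1) (h2 : 0 < c2) (hD : 0 < D) (K N : ℕ) (hN : 1 ≤ N) :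
    ∃ c > (0:ℝ), ∀ u τ g : ℝ, 0 ≤ u → u ≤ 1 → 0 ≤ τ → τ ≤ 1 → 0 ≤ g → g ≤ 1 →
      c1 * u ^ N ≤ g → c2 * τ ^ K ≤ D * max u g → c * (max u τ) ^ (K * N + N) ≤ g := by
  have hE : 0 < 1 / c1 + 1 := by positivity
  refine ⟨min c1 (c2 ^ N / (D ^ N * (1 / c1 + 1))), lt_min h1 (by positivity), ?_⟩
  intro u τ g hu hu1 hτ hτ1 hg hg1 ha hb
  have hmax : (max u g) ^ N ≤ (1 / c1 + 1) * g := by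
    rcases max_cases u g with ⟨h, -⟩ | ⟨h, -⟩ <;> rw [h]
    · have : u ^ N ≤ 1 / c1 * g := by
        rw [one_div, ← div_eq_inv_mul, le_div_iff₀ h1]; linarith
      nlinarith
    · have : g ^ N ≤ g := pow_le_of_le_one hg hg1 (by omega)
      have : 0 ≤ 1 / c1 * g := by positivity
      nlinarith
  have hτN : c2 ^ N * τ ^ (K * N) ≤ D ^ N * ((1 / c1 + 1) * g) := by
    have : (c2 * τ ^ K) ^ N ≤ (D * max u g) ^ N := pow_le_pow_left₀ (by positivity) hb N
    rw [mul_pow, mul_pow, ← pow_mul] at this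
    exact this.trans (by gcongr)
  rcases max_cases u τ with ⟨h, -⟩ | ⟨h, -⟩ <;> rw [h]
  · have : u ^ (K * N + N) ≤ u ^ N := pow_le_pow_of_le_one hu hu1 (by omega)
    calc _ ≤ c1 * u ^ N := mul_le_mul (min_le_left _ _) this (by positivity) h1.le
      _ ≤ g := ha
  · have : τ ^ (K * N + N) ≤ τ ^ (K * N) := pow_le_pow_of_le_one hτ hτ1 (by omega)
    calc _ ≤ c2 ^ N / (D ^ N * (1 / c1 + 1)) * τ ^ (K * N) :=
          mul_le_mul (min_le_right _ _) this (by positivity) (by positivity)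
      _ ≤ g := by
        rw [div_mul_eq_mul_div, div_le_iff₀ (by positivity)]; linarith

def TT (V : Type) [NormedAddCommGroup V] [NormedSpace ℝ V] : Prop :=
  ∀ g : V → ℝ, Continuous g → g 0 = 0 → (∀ᶠ x in 𝓝 (0:V), x ≠ 0 → 0 < g x) →
    ∀ P : V × ℝ → ℝ, AnalyticAt ℝ P 0 → (¬ ∀ᶠ z in 𝓝 (0 : V × ℝ), P z = 0) →
      (∀ᶠ x in 𝓝 (0:V), P (x, g x) = 0) →
      ∃ c > (0:ℝ), ∃ N : ℕ, 1 ≤ N ∧ ∀ᶠ x in 𝓝 (0:V), c * ‖x‖ ^ N ≤ g x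

theorem split_step {X : Type} [NormedAddCommGroup X] [NormedSpace ℝ X] [FiniteDimensional ℝ X]
    (IH : TT X) (g : X × ℝ → ℝ) (hg : Continuous g) (g0 : g 0 = 0)
    (hpos : ∀ᶠ x in 𝓝 (0 : X × ℝ), x ≠ 0 → 0 < g x)
    (Q : (X × ℝ) × ℝ → ℝ) (hQ : AnalyticAt ℝ Q 0)
    (hQ0 : ¬ ∀ᶠ t in 𝓝 (0:ℝ), Q ((0, t), 0) = 0)
    (hQg : ∀ᶠ z in 𝓝 (0 : X × ℝ), Q (z, g z) = 0) :
    ∃ c > (0:ℝ), ∃ N : ℕ, 1 ≤ N ∧ ∀ᶠ x in 𝓝 (0 : X × ℝ), c * ‖x‖ ^ N ≤ g x := by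
  -- Weierstrass polynomial and elimination
  have hf : AnalyticAt ℝ (fun w : (X × ℝ) × ℝ => Q ((w.1.1, w.2), w.1.2)) 0 := by
    refine AnalyticAt.fun_comp (g := Q) (f := fun w : (X × ℝ) × ℝ => ((w.1.1, w.2), w.1.2)) hQ ?_
    exact ((analyticAt_fst.fun_comp analyticAt_fst).prod analyticAt_snd).prod
      (analyticAt_snd.fun_comp analyticAt_fst)
  obtain ⟨d, a, ha, hda⟩ := wprep _ hf hQ0
  have hv : ∀ᶠ z in 𝓝 (0 : X × ℝ),
      z.2 ^ d + ∑ i : Fin d, a i (z.1, g z) * z.2 ^ (i:ℕ) = 0 := by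
    have ht : Tendsto (fun z : X × ℝ => ((z.1, g z), z.2)) (𝓝 0) (𝓝 0) := by
      have : Continuous (fun z : X × ℝ => ((z.1, g z), z.2)) := by fun_prop
      have := this.tendsto 0
      rw [g0] at this
      exact this
    filter_upwards [ht.eventually hda, hQg] with z h1 h2 using h1 h2
  obtain ⟨δ, hδ, hδ0, hδm⟩ := elim_lemma g hg g0 d a ha hv
  obtain ⟨ε', hε', hball⟩ := Metric.eventually_nhds_iff_ball.1 (hpos.and hδm)
  obtain ⟨ε, hε, hεε⟩ : ∃ ε > 0, ε < ε' := ⟨ε' / 2, by linarith, by linarith⟩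
  have hin : ∀ (x : X) (t : ℝ), ‖x‖ ≤ ε → t ∈ Set.Icc (-ε) ε → (x, t) ∈ ball (0 : X × ℝ) ε' := by
    intro x t hx ht
    rw [mem_ball_zero_iff]
    refine lt_of_le_of_lt (norm_prod_le_iff.2 ⟨hx, ?_⟩) hεε
    exact abs_le.2 ht
  let G : X → ℝ := fun x => sInf ((fun t => g (x, t)) '' Set.Icc (-ε) ε)
  have hGc : Continuous G := isCompact_Icc.continuous_sInf (f := fun x t => g (x, t)) hg
  have hne : (Set.Icc (-ε) ε).Nonempty := ⟨0, by constructor <;> linarith⟩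
  have hGle : ∀ x, ∀ t ∈ Set.Icc (-ε) ε, G x ≤ g (x, t) := by
    intro x t ht
    refine csInf_le ?_ ⟨t, ht, rfl⟩
    exact (isCompact_Icc.image (by fun_prop)).bddBelow
  have hGat : ∀ x, ∃ t ∈ Set.Icc (-ε) ε, G x = g (x, t) := by
    intro x
    obtain ⟨t, ht, h⟩ := isCompact_Icc.exists_sInf_image_eq hne
      (f := fun t => g (x, t)) (by fun_prop)
    exact ⟨t, ht, h⟩
  have hGpos : ∀ x, x ≠ 0 → ‖x‖ ≤ ε → 0 < G x := by
    intro x hx0 hx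
    obtain ⟨t, ht, h⟩ := hGat x
    rw [h]
    exact (hball _ (hin x t hx ht)).1 (fun h => hx0 (congrArg Prod.fst h))
  have h0in : (0:ℝ) ∈ Set.Icc (-ε) ε := by constructor <;> linarith
  have hG0 : G 0 = 0 := by
    apply le_antisymm
    · have := hGle 0 0 h0in
      rwa [show ((0:X), (0:ℝ)) = 0 from rfl, g0] at this
    · obtain ⟨t, ht, h⟩ := hGat 0
      rw [h]
      by_cases hz : ((0:X), t) = 0
      · rw [hz, g0]
      · exact ((hball _ (hin 0 t (by simpa using hε.le) ht)).1 hz).le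
  have hxε : ∀ᶠ x in 𝓝 (0:X), ‖x‖ ≤ ε := by
    filter_upwards [closedBall_mem_nhds (0:X) hε] with x hx
    simpa using hx
  have hend : ∀ s : ℝ, s ∈ Set.Icc (-ε) ε → s ≠ 0 → ∀ᶠ x in 𝓝 (0:X), G x < g (x, s) := by
    intro s hs hs0
    have : Continuous (fun x => g (x, s)) := by fun_prop
    refine hGc.continuousAt.eventually_lt this.continuousAt ?_
    rw [hG0]
    refine (hball _ (hin 0 s (by simpa using hε.le) hs)).1 fun h => hs0 (congrArg Prod.snd h)
  have hδG : ∀ᶠ x in 𝓝 (0:X), δ (x, G x) = 0 := by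
    filter_upwards [hxε, hend ε ⟨by linarith, le_rfl⟩ hε.ne',
      hend (-ε) ⟨le_rfl, by linarith⟩ (by linarith)] with x h1 h2 h3
    obtain ⟨t, ht, h⟩ := hGat x
    have ht1 : t ≠ ε := by rintro rfl; linarith
    have ht2 : t ≠ -ε := by rintro rfl; linarith
    rw [h]
    refine (hball _ (hin x t h1 ht)).2 ?_
    have hI : Set.Ioo (-ε) ε ∈ 𝓝 t :=
      Ioo_mem_nhds (lt_of_le_of_ne ht.1 ht2.symm) (lt_of_le_of_ne ht.2 ht1)
    filter_upwards [hI] with s hs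
    change g (x, t) ≤ g (x, s)
    rw [← h]; exact hGle x s ⟨hs.1.le, hs.2.le⟩
  obtain ⟨c1, hc1, N, hN, hGN⟩ := IH G hGc hG0
    (by filter_upwards [hxε] with x hx hx0 using hGpos x hx0 hx) δ hδ hδ0 hδG
  -- one variable bound
  have hq : AnalyticAt ℝ (fun t : ℝ => Q ((0, t), 0)) 0 := by
    refine AnalyticAt.fun_comp (g := Q) (f := fun t : ℝ => (((0:X), t), (0:ℝ))) hQ ?_
    exact (analyticAt_const.prod analyticAt_id).prod analyticAt_const
  obtain ⟨K, w, hw, hw0, hqw⟩ := hq.exists_eventuallyEq_pow_smul_nonzero_iff.2 hQ0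
  have hwe : ∀ᶠ t in 𝓝 (0:ℝ), |w 0| / 2 < |w t| := by
    refine (hw.continuousAt.abs).eventually (lt_mem_nhds ?_)
    have := abs_pos.2 hw0; linarith
  -- Lipschitz
  obtain ⟨D, s, hs, hLip⟩ := hQ.hasStrictFDerivAt.exists_lipschitzOnWith
  have hs1 : ∀ᶠ z in 𝓝 (0 : X × ℝ), (z, g z) ∈ s := by
    have ht : Tendsto (fun z : X × ℝ => (z, g z)) (𝓝 0) (𝓝 0) := by
      have : Continuous (fun z : X × ℝ => (z, g z)) := by fun_prop
      have := this.tendsto 0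
      rw [g0] at this
      exact this
    exact ht.eventually hs
  have hs2 : ∀ᶠ z in 𝓝 (0 : X × ℝ), (((0:X), z.2), (0:ℝ)) ∈ s := by
    have ht : Tendsto (fun z : X × ℝ => (((0:X), z.2), (0:ℝ))) (𝓝 0) (𝓝 0) := by
      have : Continuous (fun z : X × ℝ => (((0:X), z.2), (0:ℝ))) := by fun_prop
      exact this.tendsto 0
    exact ht.eventually hs
  obtain ⟨c, hc, hreal⟩ := real_lem hc1 (c2 := |w 0| / 2) (by have := abs_pos.2 hw0; linarith)
    (D := D + 1) (by positivity) K N hN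
  refine ⟨c, hc, K * N + N, by omega, ?_⟩
  have t1 : Tendsto (fun z : X × ℝ => z.1) (𝓝 0) (𝓝 0) := continuous_fst.tendsto 0
  have t2 : Tendsto (fun z : X × ℝ => z.2) (𝓝 0) (𝓝 0) := continuous_snd.tendsto 0
  have hle1 : ∀ᶠ z in 𝓝 (0 : X × ℝ), ‖z‖ ≤ 1 := by
    filter_upwards [closedBall_mem_nhds (0 : X × ℝ) one_pos] with x hx
    simpa using hx
  have hleε : ∀ᶠ z in 𝓝 (0 : X × ℝ), ‖z‖ ≤ ε := by
    filter_upwards [closedBall_mem_nhds (0 : X × ℝ) hε] with x hx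
    simpa using hx
  have hg1 : ∀ᶠ z in 𝓝 (0 : X × ℝ), g z < 1 :=
    hg.continuousAt.eventually (gt_mem_nhds (by rw [g0]; exact one_pos))
  filter_upwards [hle1, hleε, hg1, hpos, hs1, hs2, t2.eventually hwe, t2.eventually hqw,
    t1.eventually hGN, hQg] with z h1 h2 h3 h4 h5 h6 h7 h8 h9 h10
  have hz1 : ‖z.1‖ ≤ ‖z‖ := norm_fst_le z
  have hz2 : |z.2| ≤ ‖z‖ := norm_snd_le z
  have hgz : 0 ≤ g z := by
    by_cases hz : z = 0
    · rw [hz, g0]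
    · exact (h4 hz).le
  refine hreal ‖z.1‖ |z.2| (g z) (norm_nonneg _) (hz1.trans h1) (abs_nonneg _) (hz2.trans h1)
    hgz h3.le ?_ ?_
  · exact h9.trans (hGle z.1 z.2 (abs_le.1 (hz2.trans h2)))
  · have k1 := hLip.dist_le_mul _ h6 _ h5
    rw [h10, h8] at k1
    have k2 : dist ((((0:X), z.2), (0:ℝ))) (z, g z) = max ‖z.1‖ (g z) := by
      rw [Prod.dist_eq, Prod.dist_eq]
      simp [Real.dist_eq, abs_of_nonneg hgz]
    rw [k2, Real.dist_eq] at k1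
    simp only [sub_zero, smul_eq_mul, abs_mul, abs_pow] at k1
    calc |w 0| / 2 * |z.2| ^ K ≤ |z.2| ^ K * |w z.2| := by
          rw [mul_comm]; exact mul_le_mul_of_nonneg_left h7.le (by positivity)
      _ ≤ D * max ‖z.1‖ (g z) := k1
      _ ≤ (D + 1) * max ‖z.1‖ (g z) := by
          have : 0 ≤ max ‖z.1‖ (g z) := le_max_of_le_left (norm_nonneg _)
          nlinarith

theorem main_ind (n : ℕ) : ∀ (V : Type) [NormedAddCommGroup V] [NormedSpace ℝ V]
    [FiniteDimensional ℝ V], Module.finrank ℝ V = n → TT V := by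
  induction n with
  | zero =>
    intro V _ _ _ hn g hg g0 _ P _ _ _
    have := Module.finrank_zero_iff.1 hn
    refine ⟨1, one_pos, 1, le_rfl, Filter.Eventually.of_forall fun x => ?_⟩
    rw [Subsingleton.elim x 0, g0]; simp
  | succ n ih =>
    intro V _ _ _ hn g hg g0 hpos P hP hP0 hPg
    have : Nontrivial V := Module.nontrivial_of_finrank_pos (R := ℝ) (by omega)
    obtain ⟨k, Q, hQ, hQ0, hPQ⟩ := divis P hP hP0
    have tg : Tendsto (fun x : V => (x, g x)) (𝓝 0) (𝓝 0) := by
      have : Continuous (fun x : V => (x, g x)) := by fun_prop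
      have := this.tendsto 0
      rw [g0] at this
      exact this
    have hQg' : ∀ᶠ x in 𝓝 (0:V), x ≠ 0 → Q (x, g x) = 0 := by
      filter_upwards [hpos, hPg, tg.eventually hPQ] with x h1 h2 h3 hx
      rw [h2] at h3
      exact (mul_eq_zero.1 h3.symm).resolve_left (pow_ne_zero _ (h1 hx).ne')
    have hQc : ContinuousAt (fun x : V => Q (x, g x)) 0 := by
      refine ContinuousAt.comp (g := Q) (f := fun x : V => (x, g x)) ?_ (by fun_prop)
      rw [g0]; exact hQ.continuousAt
    have hQg : ∀ᶠ x in 𝓝 (0:V), Q (x, g x) = 0 :=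
      (ContinuousAt.eventuallyEq_nhds_iff_eventuallyEq_nhdsNE hQc
        (g := fun _ => (0:ℝ)) continuousAt_const).1 (eventually_nhdsWithin_iff.2 hQg')
    have hQ00 : Q (0, 0) = 0 := by
      have := hQg.self_of_nhds
      rwa [g0] at this
    have hq : AnalyticAt ℝ (fun x : V => Q (x, 0)) 0 := by
      refine AnalyticAt.fun_comp (g := Q) (f := fun x : V => (x, (0:ℝ))) hQ ?_
      exact analyticAt_id.prod analyticAt_const
    obtain ⟨r, hr, hb⟩ := an_ball hq
    obtain ⟨v, hvr, hv⟩ : ∃ v ∈ ball (0:V) r, Q (v, 0) ≠ 0 := by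
      by_contra! h
      exact hQ0 (by filter_upwards [ball_mem_nhds (0:V) hr] with x hx using h x hx)
    have hv0 : v ≠ 0 := by rintro rfl; exact hv hQ00
    have hline : ¬ ∀ᶠ t in 𝓝 (0:ℝ), Q (t • v, 0) = 0 := by
      intro h
      have hA : AnalyticOnNhd ℝ (fun t : ℝ => Q (t • v, 0)) (Set.Icc 0 1) := by
        intro t ht
        refine AnalyticAt.fun_comp (g := fun x : V => Q (x, 0)) (f := fun t : ℝ => t • v)
          (hb _ ?_) (analyticAt_id.smul analyticAt_const)
        rw [mem_ball_zero_iff] at hvr ⊢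
        rw [norm_smul, Real.norm_eq_abs, abs_of_nonneg ht.1]
        have := ht.2
        nlinarith [norm_nonneg v]
      have := hA.eqOn_zero_of_preconnected_of_eventuallyEq_zero isPreconnected_Icc
        (Set.left_mem_Icc.2 zero_le_one) h (Set.right_mem_Icc.2 zero_le_one)
      simp only [one_smul] at this
      exact hv this
    obtain ⟨f, hf⟩ := SeparatingDual.exists_eq_one (R := ℝ) hv0
    let e1 := ContinuousLinearEquiv.equivOfRightInverse f
      (ContinuousLinearMap.toSpanSingleton ℝ v) (fun t => by simp [hf])
    let e : V ≃L[ℝ] f.ker × ℝ := e1.trans (ContinuousLinearEquiv.prodComm ℝ ℝ f.ker)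
    have hes : ∀ t : ℝ, e.symm (0, t) = t • v := by
      intro t
      rw [ContinuousLinearEquiv.symm_apply_eq]
      refine Prod.ext ?_ ?_
      · apply Subtype.ext
        simp [e, e1, hf]
      · simp [e, e1, hf]
    have hfr : Module.finrank ℝ f.ker = n := by
      have := e.toLinearEquiv.finrank_eq
      rw [Module.finrank_prod, Module.finrank_self, hn] at this
      omega
    have hes0 : Tendsto e.symm (𝓝 0) (𝓝 0) := by
      have := e.symm.continuous.tendsto 0
      rwa [map_zero] at this
    obtain ⟨c, hc, N, hN, hcN⟩ := split_step (ih f.ker hfr) (fun z => g (e.symm z))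
      (hg.comp e.symm.continuous) (by rw [map_zero, g0])
      (by
        filter_upwards [hes0.eventually hpos] with z hz hz0
        exact hz (by simpa using hz0))
      (fun w => Q (e.symm w.1, w.2))
      (by
        refine AnalyticAt.fun_comp (g := Q) (f := fun w : (f.ker × ℝ) × ℝ => (e.symm w.1, w.2)) ?_ ?_
        · have h00 : (e.symm (0 : (f.ker × ℝ) × ℝ).1, (0 : (f.ker × ℝ) × ℝ).2) = (0 : V × ℝ) :=
            Prod.ext (by simp) rfl
          rw [h00]; exact hQ
        · exact ((e.symm.analyticAt _).fun_comp analyticAt_fst).prod analyticAt_snd)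
      (by simpa only [hes] using hline)
      (hes0.eventually hQg)
    refine ⟨c / (‖(e.symm : f.ker × ℝ →L[ℝ] V)‖ + 1) ^ N, by positivity, N, hN, ?_⟩
    have he0 : Tendsto e (𝓝 0) (𝓝 0) := by
      have := e.continuous.tendsto 0
      rwa [map_zero] at this
    filter_upwards [he0.eventually hcN] with x hx
    rw [e.symm_apply_apply] at hx
    refine le_trans ?_ hx
    rw [div_mul_eq_mul_div, div_le_iff₀ (by positivity), mul_assoc, ← mul_pow]
    have hx2 : ‖x‖ ≤ ‖e x‖ * (‖(e.symm : f.ker × ℝ →L[ℝ] V)‖ + 1) := by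
      have := (e.symm : f.ker × ℝ →L[ℝ] V).le_opNorm (e x)
      rw [ContinuousLinearEquiv.coe_coe, e.symm_apply_apply] at this
      nlinarith [norm_nonneg (e x)]
    gcongr

/-- Łojasiewicz inequality for an analytic function with an isolated zero at the origin. -/
theorem lojasiewicz_inequality (n : ℕ) (U : Set (EuclideanSpace ℝ (Fin n)))
    (h : EuclideanSpace ℝ (Fin n) → ℝ)
    (hU : IsOpen U) (h0U : (0 : EuclideanSpace ℝ (Fin n)) ∈ U)
    (hana : AnalyticOnNhd ℝ h U)
    (hiso : ∃ ρ > (0 : ℝ), Metric.ball (0 : EuclideanSpace ℝ (Fin n)) ρ ⊆ U ∧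
      {u : EuclideanSpace ℝ (Fin n) | ‖u‖ < ρ ∧ h u = 0} = {0}) :
    ∃ r > (0 : ℝ), ∃ c > (0 : ℝ), ∃ α > (0 : ℝ),
      ∀ u : EuclideanSpace ℝ (Fin n), ‖u‖ < r → c * ‖u‖ ^ α ≤ |h u| := by
  obtain ⟨ρ, hρ, hρU, hz⟩ := hiso
  have h00 : h 0 = 0 := by
    have : (0 : EuclideanSpace ℝ (Fin n)) ∈ {u : EuclideanSpace ℝ (Fin n) | ‖u‖ < ρ ∧ h u = 0} := by
      rw [hz]; rfl
    exact this.2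
  set R := ρ / 2 with hR
  have hR0 : 0 < R := by positivity
  set σ : EuclideanSpace ℝ (Fin n) → EuclideanSpace ℝ (Fin n) :=
    fun x => (R / max ‖x‖ R) • x with hσ
  have hmx : ∀ x : EuclideanSpace ℝ (Fin n), 0 < max ‖x‖ R := fun x => lt_max_of_lt_right hR0
  have hσc : Continuous σ := by
    have hq : Continuous fun x : EuclideanSpace ℝ (Fin n) => R / max ‖x‖ R :=
      continuous_const.div (continuous_norm.max continuous_const) fun x => (hmx x).ne'
    exact hq.smul continuous_id
  have hσn : ∀ x, ‖σ x‖ < ρ := by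
    intro x
    have : ‖σ x‖ ≤ R := by
      simp only [hσ]
      rw [norm_smul, Real.norm_of_nonneg (div_nonneg hR0.le (hmx x).le), div_mul_eq_mul_div,
        div_le_iff₀ (hmx x)]
      exact mul_le_mul_of_nonneg_left (le_max_left _ _) hR0.le
    linarith
  have hσe : ∀ x : EuclideanSpace ℝ (Fin n), ‖x‖ < R → σ x = x := by
    intro x hx
    simp only [hσ]
    rw [max_eq_right hx.le, div_self hR0.ne', one_smul]
  have hcont : Continuous fun x => h (σ x) := by
    refine continuous_iff_continuousAt.2 fun x => ?_
    exact ContinuousAt.comp (f := σ) (g := h)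
      (hana (σ x) (hρU (by simpa using hσn x))).continuousAt hσc.continuousAt
  have hnear : ∀ᶠ x : EuclideanSpace ℝ (Fin n) in 𝓝 0, ‖x‖ < R := by
    filter_upwards [Metric.ball_mem_nhds (0 : EuclideanSpace ℝ (Fin n)) hR0] with x hx
    simpa using hx
  have hP : AnalyticAt ℝ (fun z : EuclideanSpace ℝ (Fin n) × ℝ => z.2 - h z.1 ^ 2) 0 := by
    refine analyticAt_snd.sub (AnalyticAt.pow ?_ 2)
    exact AnalyticAt.fun_comp (g := h) (f := fun z : EuclideanSpace ℝ (Fin n) × ℝ => z.1)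
      (hana 0 h0U) analyticAt_fst
  have key := main_ind n (EuclideanSpace ℝ (Fin n)) (by simp)
  obtain ⟨c, hc, N, hN, hcN⟩ := key (fun x => h (σ x) ^ 2) (hcont.pow 2)
    (by simp [hσ, h00])
    (by
      filter_upwards [hnear] with x hx hx0
      rw [hσe x hx]
      have : h x ≠ 0 := by
        intro hh
        have hm : x ∈ {u : EuclideanSpace ℝ (Fin n) | ‖u‖ < ρ ∧ h u = 0} :=
          ⟨by linarith, hh⟩
        rw [hz] at hm
        exact hx0 hm
      positivity)
    (fun z => z.2 - h z.1 ^ 2) hP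
    (by
      intro hev
      have ht : Tendsto (fun s : ℝ => ((0 : EuclideanSpace ℝ (Fin n)), s)) (𝓝 0) (𝓝 0) := by
        have hcc : Continuous (fun s : ℝ => ((0 : EuclideanSpace ℝ (Fin n)), s)) := by fun_prop
        exact hcc.tendsto (0:ℝ)
      have h1 := ht.eventually hev
      obtain ⟨r, hr, h2⟩ := Metric.eventually_nhds_iff_ball.1 h1
      have h3 := h2 (r / 2) (by
        rw [mem_ball, Real.dist_eq, sub_zero, abs_of_pos (by positivity)]; linarith)
      simp only [h00] at h3
      linarith)
    (by
      filter_upwards [hnear] with x hx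
      rw [hσe x hx]; ring)
  have hsm : ∀ᶠ x : EuclideanSpace ℝ (Fin n) in 𝓝 0, |h (σ x)| < 1 := by
    have := (hcont.abs.tendsto 0).eventually_lt_const (u := (1:ℝ))
      (by simp [hσ, h00])
    exact this
  obtain ⟨r, hr, hall⟩ := Metric.eventually_nhds_iff_ball.1 (hcN.and (hsm.and hnear))
  refine ⟨r, hr, c, hc, (N : ℝ), by exact_mod_cast hN, fun u hu => ?_⟩
  obtain ⟨k1, k2, k3⟩ := hall u (by simpa using hu)
  rw [Real.rpow_natCast]
  rw [hσe u k3] at k2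
  simp only [hσe u k3] at k1
  refine k1.trans ?_
  rw [← sq_abs]
  nlinarith [abs_nonneg (h u)]
end

section
/- liminf_{(x,y,z)→0} (x⁴ + 2x² + 2y⁴) / (−x⁴ − 12x²y² − 24x² − 12y⁴ − 48y² − 48z⁴) · 96/2 computed as: the quotient (x⁴+2x²+2y⁴)/2 divided by (−x⁴−12x²y²−24x²−12y⁴−48y²−48z⁴)/96 has lower limit −4 and upper limit 0 as (x,y,z) → (0,0,0). -/
open Filter

noncomputable def auxF (q : ℝ × ℝ × ℝ) : ℝ :=
  (q.1 ^ 4 + 2 * q.1 ^ 2 + 2 * q.2.1 ^ 4) / 2 /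
            ((-q.1 ^ 4 - 12 * q.1 ^ 2 * q.2.1 ^ 2 - 24 * q.1 ^ 2 - 12 * q.2.1 ^ 4
              - 48 * q.2.1 ^ 2 - 48 * q.2.2 ^ 4) / 96)

def auxS : Set (ℝ × ℝ × ℝ) := {q : ℝ × ℝ × ℝ |
          (-q.1 ^ 4 - 12 * q.1 ^ 2 * q.2.1 ^ 2 - 24 * q.1 ^ 2 - 12 * q.2.1 ^ 4
            - 48 * q.2.1 ^ 2 - 48 * q.2.2 ^ 4) / 96 ≠ 0}

lemma auxF_nonpos (q : ℝ × ℝ × ℝ) : auxF q ≤ 0 := by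
  unfold auxF
  apply div_nonpos_of_nonneg_of_nonpos
  · positivity
  · have : 0 ≤ q.1 ^ 4 + 12 * q.1 ^ 2 * q.2.1 ^ 2 + 24 * q.1 ^ 2 + 12 * q.2.1 ^ 4
              + 48 * q.2.1 ^ 2 + 48 * q.2.2 ^ 4 := by positivity
    linarith

lemma auxF_lower (q : ℝ × ℝ × ℝ) (hq : q ∈ auxS) (e : ℝ) (he : 0 < e)
    (hx : q.1 ^ 2 < e / 2) (hy : q.2.1 ^ 2 < 2) : -4 - e ≤ auxF q := by
  obtain ⟨x, y, z⟩ := q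
  simp only [auxS, Set.mem_ofPred_eq] at hq
  simp only [auxF] at *
  have h0 : 0 ≤ x ^ 4 + 12 * x ^ 2 * y ^ 2 + 24 * x ^ 2 + 12 * y ^ 4
              + 48 * y ^ 2 + 48 * z ^ 4 := by positivity
  have hneg : (-x ^ 4 - 12 * x ^ 2 * y ^ 2 - 24 * x ^ 2 - 12 * y ^ 4
              - 48 * y ^ 2 - 48 * z ^ 4) / 96 < 0 := lt_of_le_of_ne (by linarith) hq
  rw [le_div_iff_of_neg hneg]
  have h1 : x ^ 4 ≤ e / 2 * x ^ 2 := by nlinarith [sq_nonneg x]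
  have h2 : y ^ 4 ≤ 2 * y ^ 2 := by nlinarith [sq_nonneg y]
  have h3 : 0 ≤ e * (x ^ 4 + 12 * x ^ 2 * y ^ 2 + 12 * y ^ 4
              + 48 * y ^ 2 + 48 * z ^ 4) := by positivity
  have h4 : 0 ≤ x ^ 4 + 12 * x ^ 2 * y ^ 2 + 12 * y ^ 4 + 48 * z ^ 4 := by positivity
  linarith

lemma aux_tendsto (u : ℝ → ℝ × ℝ × ℝ) (hu : Continuous u) (h0 : u 0 = 0)
    (hS : ∀ t, t ≠ 0 → u t ∈ auxS) :
    Tendsto u (nhdsWithin 0 {0}ᶜ) (nhdsWithin 0 auxS) := by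
  apply tendsto_nhdsWithin_of_tendsto_nhds_of_eventually_within
  · have := hu.tendsto 0
    rw [h0] at this
    exact this.mono_left nhdsWithin_le_nhds
  · filter_upwards [self_mem_nhdsWithin] with t ht using hS t ht

lemma aux_x : Tendsto (fun t : ℝ => (t, (0:ℝ), (0:ℝ))) (nhdsWithin 0 {0}ᶜ) (nhdsWithin 0 auxS) := by
  apply aux_tendsto _ (by fun_prop) rfl
  intro t ht
  have : 0 < t ^ 2 := by positivity
  simp only [auxS, Set.mem_ofPred_eq]
  apply ne_of_lt
  nlinarith [sq_nonneg (t ^ 2)]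

lemma aux_z : Tendsto (fun t : ℝ => ((0:ℝ), (0:ℝ), t)) (nhdsWithin 0 {0}ᶜ) (nhdsWithin 0 auxS) := by
  apply aux_tendsto _ (by fun_prop) rfl
  intro t ht
  simp [auxS, ht]

lemma aux_lim : Tendsto (fun t : ℝ => auxF (t, 0, 0)) (nhdsWithin 0 {0}ᶜ) (nhds (-4)) := by
  have h : Tendsto (fun t : ℝ => -((t ^ 2 / 2 + 1) / (t ^ 2 / 96 + 1 / 4))) (nhdsWithin 0 {0}ᶜ)
      (nhds (-4)) := by
    have hc : Continuous (fun t : ℝ => -((t ^ 2 / 2 + 1) / (t ^ 2 / 96 + 1 / 4))) := by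
      refine (Continuous.div (by fun_prop) (by fun_prop) fun t => ?_).neg
      positivity
    have h4 := hc.tendsto 0
    have h5 : -(((0:ℝ) ^ 2 / 2 + 1) / ((0:ℝ) ^ 2 / 96 + 1 / 4)) = -4 := by norm_num
    rw [h5] at h4
    exact h4.mono_left nhdsWithin_le_nhds
  refine h.congr' ?_
  filter_upwards [self_mem_nhdsWithin] with t ht
  have ht : t ≠ 0 := ht
  simp only [auxF]
  have h1 : t ^ 2 / 96 + 1 / 4 ≠ 0 := by positivity
  have h2 : (-t ^ 4 - 12 * t ^ 2 * 0 ^ 2 - 24 * t ^ 2 - 12 * 0 ^ 4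
      - 48 * 0 ^ 2 - 48 * 0 ^ 4) / 96 = -(t ^ 2 * (t ^ 2 / 96 + 1 / 4)) := by ring
  have h3 : (t ^ 4 + 2 * t ^ 2 + 2 * 0 ^ 4) / 2 = t ^ 2 * (t ^ 2 / 2 + 1) := by ring
  rw [h2, h3, div_neg, mul_div_mul_left _ _ (pow_ne_zero 2 ht)]

lemma aux_main :
    Filter.liminf (fun q => (auxF q : EReal)) (nhdsWithin 0 auxS) = -4 ∧
    Filter.limsup (fun q => (auxF q : EReal)) (nhdsWithin 0 auxS) = 0 := by
  refine ⟨le_antisymm ?_ ?_, le_antisymm ?_ ?_⟩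
  · have h : Tendsto (fun t : ℝ => (auxF (t, 0, 0) : EReal)) (nhdsWithin 0 {0}ᶜ)
        (nhds ((-4 : ℝ) : EReal)) :=
      (continuous_coe_real_ereal.tendsto _).comp aux_lim
    have h2 := h.liminf_eq
    calc _ ≤ liminf (fun q => (auxF q : EReal))
              (map (fun t : ℝ => (t, (0:ℝ), (0:ℝ))) (nhdsWithin 0 {0}ᶜ)) :=
            liminf_le_liminf_of_le aux_x
      _ = ((-4 : ℝ) : EReal) := h2
      _ = -4 := rfl
  · apply le_of_forall_lt
    intro a ha
    have ha' : a < ((-4 : ℝ) : EReal) := ha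
    obtain ⟨c, hac, hc⟩ := EReal.lt_iff_exists_real_btwn.1 ha'
    refine lt_of_lt_of_le hac ?_
    have hc : c < -4 := EReal.coe_lt_coe_iff.1 hc
    apply le_liminf_of_le
    · isBoundedDefault
    have e1 : ∀ᶠ q : ℝ × ℝ × ℝ in nhds 0, q.1 ^ 2 < (-4 - c) / 2 := by
      have : Continuous (fun q : ℝ × ℝ × ℝ => q.1 ^ 2) := by fun_prop
      apply (this.tendsto 0).eventually_lt_const
      simp
      linarith
    have e2 : ∀ᶠ q : ℝ × ℝ × ℝ in nhds 0, q.2.1 ^ 2 < 2 := by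
      have : Continuous (fun q : ℝ × ℝ × ℝ => q.2.1 ^ 2) := by fun_prop
      apply (this.tendsto 0).eventually_lt_const
      simp
    filter_upwards [self_mem_nhdsWithin, nhdsWithin_le_nhds e1, nhdsWithin_le_nhds e2]
      with q h1 h2 h3
    have := auxF_lower q h1 (-4 - c) (by linarith) h2 h3
    exact EReal.coe_le_coe_iff.2 (by linarith)
  · apply limsup_le_of_le
    · isBoundedDefault
    exact Eventually.of_forall fun q => by exact_mod_cast auxF_nonpos q
  · have h2 : limsup (fun t : ℝ => (auxF (0, 0, t) : EReal)) (nhdsWithin 0 {0}ᶜ) = 0 := by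
      have : (fun t : ℝ => (auxF (0, 0, t) : EReal)) = fun _ => 0 := by
        funext t
        simp [auxF]
      rw [this, limsup_const]
    calc (0 : EReal) = limsup (fun q => (auxF q : EReal))
              (map (fun t : ℝ => ((0:ℝ), (0:ℝ), t)) (nhdsWithin 0 {0}ᶜ)) := h2.symm
      _ ≤ _ := limsup_le_limsup_of_le aux_z

/-- For `G = (x⁴ + 2x² + 2y⁴)/2` and `H = (−x⁴ − 12x²y² − 24x² − 12y⁴ − 48y² − 48z⁴)/96`,
the lower limit of `G/H` at the origin is `-4` and the upper limit is `0`. -/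
theorem liminf_limsup_taylor_quotient_example :
    Filter.liminf
        (fun q : ℝ × ℝ × ℝ =>
          (((q.1 ^ 4 + 2 * q.1 ^ 2 + 2 * q.2.1 ^ 4) / 2 /
            ((-q.1 ^ 4 - 12 * q.1 ^ 2 * q.2.1 ^ 2 - 24 * q.1 ^ 2 - 12 * q.2.1 ^ 4
              - 48 * q.2.1 ^ 2 - 48 * q.2.2 ^ 4) / 96) : ℝ) : EReal))
        (nhdsWithin 0 {q : ℝ × ℝ × ℝ |
          (-q.1 ^ 4 - 12 * q.1 ^ 2 * q.2.1 ^ 2 - 24 * q.1 ^ 2 - 12 * q.2.1 ^ 4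
            - 48 * q.2.1 ^ 2 - 48 * q.2.2 ^ 4) / 96 ≠ 0}) = -4 ∧
    Filter.limsup
        (fun q : ℝ × ℝ × ℝ =>
          (((q.1 ^ 4 + 2 * q.1 ^ 2 + 2 * q.2.1 ^ 4) / 2 /
            ((-q.1 ^ 4 - 12 * q.1 ^ 2 * q.2.1 ^ 2 - 24 * q.1 ^ 2 - 12 * q.2.1 ^ 4
              - 48 * q.2.1 ^ 2 - 48 * q.2.2 ^ 4) / 96) : ℝ) : EReal))
        (nhdsWithin 0 {q : ℝ × ℝ × ℝ |
          (-q.1 ^ 4 - 12 * q.1 ^ 2 * q.2.1 ^ 2 - 24 * q.1 ^ 2 - 12 * q.2.1 ^ 4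
            - 48 * q.2.1 ^ 2 - 48 * q.2.2 ^ 4) / 96 ≠ 0}) = 0 := by
  exact aux_main
end
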